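/- arXiv:1802.09223 — 2 statements merged into one kernel-verified Lean document; each statement's English description precedes it below -/
import Mathlib

section
/- Let 𝔤 be a finite-dimensional Lie algebra. If the commuting variety C₂(𝔤) is equidimensional, then mod(𝔤) = dim_k 𝔤 − max{n : 𝔤₍ₙ₎ ≠ ∅}, where mod(𝔤) = max over n of (dim 𝔤₍ₙ₎ − n). -/
/-- The Zariski topology on a `k`-vector space `V`. -/
noncomputable def zariski (k V : Type*) [CommRing k] [AddCommGroup V] [Module k V] :
    TopologicalSpace V :=
  TopologicalSpace.generateFrom
    {U | ∃ f ∈ Algebra.adjoin k {g : V → k | IsLinearMap k g}, U = {v | f v ≠ 0}}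

/-- The commuting variety of a Lie algebra. -/
def commSet (L : Type*) [LieRing L] : Set (L × L) := {p | ⁅p.1, p.2⁆ = 0}

/-- The dimension of a subset of a topological space: the Krull dimension of the
subspace. -/
noncomputable def sdim {V : Type*} (t : TopologicalSpace V) (S : Set V) : WithBot ℕ∞ :=
  @topologicalKrullDim S (TopologicalSpace.induced Subtype.val t)

/-- The rank stratum `𝔤₍ₙ₎ = {x ∈ 𝔤 : rank (ad x) = n}`. -/
def grk (k L : Type*) [CommRing k] [LieRing L] [LieAlgebra k L] (n : ℕ) : Set L :=
  {x : L | Module.finrank k (LinearMap.range (LieAlgebra.ad k L x)) = n}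

/-- `C` is an irreducible component of `Z`: a maximal irreducible subset of `Z`. -/
def IsIrrCompIn {X : Type*} (t : TopologicalSpace X) (Z C : Set X) : Prop :=
  C ⊆ Z ∧ @IsIrreducible X t C ∧
    ∀ D : Set X, D ⊆ Z → @IsIrreducible X t D → C ⊆ D → C = D


open Topology TopologicalSpace

section poly

/-- Polynomial functions on a vector space. -/
noncomputable abbrev polyFn (k V : Type*) [CommRing k] [AddCommGroup V] [Module k V] :
    Subalgebra k (V → k) := Algebra.adjoin k {g : V → k | IsLinearMap k g}

variable {k V W X : Type*} [Field k] [AddCommGroup V] [Module k V] [AddCommGroup W] [Module k W]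
  [AddCommGroup X] [Module k X]

lemma polyFn_lin (g : V →ₗ[k] k) : (fun v => g v) ∈ polyFn k V :=
  Algebra.subset_adjoin g.isLinear

lemma polyFn_const (c : k) : (fun _ => c) ∈ polyFn k V :=
  (polyFn k V).algebraMap_mem c

lemma polyFn_mul {f g : V → k} (hf : f ∈ polyFn k V) (hg : g ∈ polyFn k V) :
    (fun v => f v * g v) ∈ polyFn k V := (polyFn k V).mul_mem hf hg

lemma polyFn_add {f g : V → k} (hf : f ∈ polyFn k V) (hg : g ∈ polyFn k V) :
    (fun v => f v + g v) ∈ polyFn k V := (polyFn k V).add_mem hf hg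

lemma polyFn_sub {f g : V → k} (hf : f ∈ polyFn k V) (hg : g ∈ polyFn k V) :
    (fun v => f v - g v) ∈ polyFn k V := (polyFn k V).sub_mem hf hg

lemma polyFn_sum {ι : Type*} (s : Finset ι) {f : ι → V → k} (hf : ∀ i ∈ s, f i ∈ polyFn k V) :
    (fun v => ∑ i ∈ s, f i v) ∈ polyFn k V := by
  have := (polyFn k V).sum_mem hf
  convert this using 1
  ext v; simp

lemma polyFn_prod {ι : Type*} (s : Finset ι) {f : ι → V → k} (hf : ∀ i ∈ s, f i ∈ polyFn k V) :
    (fun v => ∏ i ∈ s, f i v) ∈ polyFn k V := by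
  have := (polyFn k V).prod_mem hf
  convert this using 1
  ext v; simp

lemma polyFn_det {n : Type*} [Fintype n] [DecidableEq n] {M : V → Matrix n n k}
    (hM : ∀ i j, (fun v => M v i j) ∈ polyFn k V) : (fun v => (M v).det) ∈ polyFn k V := by
  simp only [Matrix.det_apply']
  exact polyFn_sum _ fun σ _ => polyFn_mul (polyFn_const _) (polyFn_prod _ fun i _ => hM _ _)

lemma polyFn_adjugate {n : Type*} [Fintype n] [DecidableEq n] {M : V → Matrix n n k}
    (hM : ∀ i j, (fun v => M v i j) ∈ polyFn k V) (i j : n) :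
    (fun v => (M v).adjugate i j) ∈ polyFn k V := by
  simp only [Matrix.adjugate_apply]
  refine polyFn_det fun a b => ?_
  simp only [Matrix.updateRow_apply]
  split_ifs
  · exact polyFn_const _
  · exact hM _ _

/-- Polynomial maps. -/
def PolyMap (k : Type*) {V W : Type*} [Field k] [AddCommGroup V] [Module k V] [AddCommGroup W]
    [Module k W] (f : V → W) : Prop := ∀ g ∈ polyFn k W, (fun v => g (f v)) ∈ polyFn k V

lemma polyMap_of_lin {f : V → W} (h : ∀ g : W →ₗ[k] k, (fun v => g (f v)) ∈ polyFn k V) :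
    PolyMap k f := by
  intro g hg
  induction hg using Algebra.adjoin_induction with
  | mem x hx => exact h (IsLinearMap.mk' x hx)
  | algebraMap r => exact polyFn_const r
  | add x y _ _ hx hy => exact polyFn_add hx hy
  | mul x y _ _ hx hy => exact polyFn_mul hx hy

lemma PolyMap.comp {f : V → W} {g : W → X} (hg : PolyMap k g) (hf : PolyMap k f) :
    PolyMap k (fun v => g (f v)) := fun p hp => hf _ (hg p hp)

lemma polyMap_linear (f : V →ₗ[k] W) : PolyMap k (fun v => f v) :=
  polyMap_of_lin fun g => polyFn_lin (g ∘ₗ f)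

lemma polyMap_affine (a : W) (f : V →ₗ[k] W) : PolyMap k (fun v => a + f v) :=
  polyMap_of_lin fun g => by
    simp only [map_add]
    exact polyFn_add (polyFn_const _) (polyFn_lin (g ∘ₗ f))

lemma zariski_basis : @IsTopologicalBasis V (zariski k V)
    {U | ∃ f ∈ polyFn k V, U = {v | f v ≠ 0}} := by
  letI := zariski k V
  refine ⟨?_, ?_, rfl⟩
  · rintro _ ⟨f, hf, rfl⟩ _ ⟨g, hg, rfl⟩ x hx
    refine ⟨_, ⟨fun v => f v * g v, polyFn_mul hf hg, rfl⟩, ?_, ?_⟩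
    · exact mul_ne_zero hx.1 hx.2
    · intro v hv
      exact ⟨left_ne_zero_of_mul hv, right_ne_zero_of_mul hv⟩
  · refine Set.eq_univ_of_univ_subset (Set.subset_sUnion_of_mem ⟨fun _ => 1, polyFn_const 1, ?_⟩)
    simp

lemma zariski_isOpen {f : V → k} (hf : f ∈ polyFn k V) : IsOpen[zariski k V] {v | f v ≠ 0} :=
  isOpen_generateFrom_of_mem ⟨f, hf, rfl⟩

lemma zariski_isClosed {f : V → k} (hf : f ∈ polyFn k V) : IsClosed[zariski k V] {v | f v = 0} := by
  letI := zariski k V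
  exact ⟨zariski_isOpen hf⟩

lemma zariski_closed_sep {Z : Set V} (hZ : IsClosed[zariski k V] Z) {v : V} (hv : v ∉ Z) :
    ∃ f ∈ polyFn k V, (∀ z ∈ Z, f z = 0) ∧ f v ≠ 0 := by
  letI := zariski k V
  obtain ⟨_, ⟨f, hf, rfl⟩, h1, h2⟩ :=
    (zariski_basis (k := k) (V := V)).exists_subset_of_mem_open (Set.mem_compl hv) hZ.isOpen_compl
  refine ⟨f, hf, fun z hz => ?_, h1⟩
  by_contra h
  exact h2 h hz

lemma PolyMap.continuous {f : V → W} (hf : PolyMap k f) :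
    Continuous[zariski k V, zariski k W] f := by
  letI := zariski k V
  refine continuous_generateFrom_iff.2 ?_
  rintro _ ⟨g, hg, rfl⟩
  exact zariski_isOpen (hf g hg)

lemma zariski_submodule_closed [FiniteDimensional k V] (K : Submodule k V) :
    IsClosed[zariski k V] (K : Set V) := by
  letI := zariski k V
  have : (K : Set V) = ⋂ g : {g : V →ₗ[k] k // ∀ x ∈ K, g x = 0}, {v | g.1 v = 0} := by
    ext v
    simp only [Set.mem_iInter, Set.mem_ofPred_eq, SetLike.mem_coe]
    refine ⟨fun h g => g.2 v h, fun h => ?_⟩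
    by_contra hv
    obtain ⟨f, hf, hf'⟩ := Submodule.exists_le_ker_of_notMem hv
    exact hf (h ⟨f, fun x hx => hf' hx⟩)
  rw [this]
  exact isClosed_iInter fun g => zariski_isClosed (polyFn_lin g.1)

lemma polyFn_one_var {f : k → k} (hf : f ∈ polyFn k k) :
    ∃ p : Polynomial k, ∀ x, f x = p.eval x := by
  induction hf using Algebra.adjoin_induction with
  | mem x hx =>
    refine ⟨Polynomial.C (x 1) * Polynomial.X, fun t => ?_⟩
    have := hx.map_smul t 1
    simp at this ⊢
    rw [this, mul_comm]
  | algebraMap r => exact ⟨Polynomial.C r, fun t => by simp⟩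
  | add x y _ _ hx hy =>
    obtain ⟨p, hp⟩ := hx
    obtain ⟨q, hq⟩ := hy
    exact ⟨p + q, fun t => by simp [hp, hq]⟩
  | mul x y _ _ hx hy =>
    obtain ⟨p, hp⟩ := hx
    obtain ⟨q, hq⟩ := hy
    exact ⟨p * q, fun t => by simp [hp, hq]⟩

/-- Product of a zariski-nonvanishing pair along a line. -/
lemma zariski_line [Infinite k] {f g : V → k} (hf : f ∈ polyFn k V) (hg : g ∈ polyFn k V) (a b : V)
    (ha : f a ≠ 0) (hb : g b ≠ 0) : ∃ t : k, f (a + t • (b - a)) ≠ 0 ∧ g (a + t • (b - a)) ≠ 0 := by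
  have hl : PolyMap k (fun t : k => a + (LinearMap.toSpanSingleton k V (b - a)) t) :=
    polyMap_affine _ _
  obtain ⟨p, hp⟩ := polyFn_one_var (hl f hf)
  obtain ⟨q, hq⟩ := polyFn_one_var (hl g hg)
  simp only [LinearMap.toSpanSingleton_apply] at hp hq
  have hp0 : p ≠ 0 := by
    rintro rfl
    have := hp 0
    simp at this
    exact ha this
  have hq0 : q ≠ 0 := by
    rintro rfl
    have := hq 1
    simp at this
    exact hb this
  have hpq : p * q ≠ 0 := mul_ne_zero hp0 hq0
  by_contra! H
  apply hpq
  apply Polynomial.funext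
  intro t
  simp only [Polynomial.eval_mul, Polynomial.eval_zero, ← hp, ← hq]
  by_cases h : f (a + t • (b - a)) = 0
  · simp [h]
  · simp [H t h]

lemma zariski_affine_irred [Infinite k] (c : V) (K : Submodule k V) :
    @IsIrreducible V (zariski k V) {v | v - c ∈ K} := by
  letI := zariski k V
  refine ⟨⟨c, by simp⟩, ?_⟩
  rintro A B hA hB ⟨a, ha, haA⟩ ⟨b, hb, hbB⟩
  obtain ⟨_, ⟨f, hf, rfl⟩, ha1, hfA⟩ :=
    (zariski_basis (k := k) (V := V)).exists_subset_of_mem_open haA hA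
  obtain ⟨_, ⟨g, hg, rfl⟩, hb1, hgB⟩ :=
    (zariski_basis (k := k) (V := V)).exists_subset_of_mem_open hbB hB
  obtain ⟨t, h1, h2⟩ := zariski_line hf hg a b ha1 hb1
  refine ⟨_, ?_, hfA h1, hgB h2⟩
  have : a + t • (b - a) - c = (a - c) + t • ((b - c) - (a - c)) := by
    rw [sub_sub_sub_cancel_right]; abel
  simp only [Set.mem_ofPred_eq] at ha hb ⊢
  rw [this]
  exact K.add_mem ha (K.smul_mem _ (K.sub_mem hb ha))

lemma zariski_prod_irred [Infinite k] {Z : Set V} (hZ : @IsIrreducible V (zariski k V) Z)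
    (K : Submodule k W) : @IsIrreducible (V × W) (zariski k (V × W)) (Z ×ˢ (K : Set W)) := by
  letI := zariski k V
  letI := zariski k W
  letI t2 := zariski k (V × W)
  obtain ⟨⟨z, hz⟩, hZ⟩ := hZ
  refine ⟨⟨(z, 0), hz, K.zero_mem⟩, ?_⟩
  rintro A B hA hB ⟨⟨z1, y1⟩, ⟨hz1, hy1⟩, h1⟩ ⟨⟨z2, y2⟩, ⟨hz2, hy2⟩, h2⟩
  have cont1 : ∀ y : W, @Continuous V (V × W) (zariski k V) (zariski k (V × W)) (fun z => (z, y)) := by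
    intro y
    have := (polyMap_affine (0, y) (LinearMap.inl k V W)).continuous
    simpa using this
  have cont2 : ∀ z : V, @Continuous W (V × W) (zariski k W) (zariski k (V × W)) (fun y => (z, y)) := by
    intro z
    have := (polyMap_affine (z, 0) (LinearMap.inr k V W)).continuous
    simpa using this
  obtain ⟨z3, hz3, h3A, h3B⟩ := hZ _ _ (@IsOpen.preimage _ _ _ t2 _ (cont1 y1) _ hA)
    (@IsOpen.preimage _ _ _ t2 _ (cont1 y2) _ hB)
    ⟨z1, hz1, h1⟩ ⟨z2, hz2, h2⟩
  have hK := (zariski_affine_irred (0 : W) K).2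
  simp only [sub_zero] at hK
  obtain ⟨y3, hy3, h4A, h4B⟩ := hK _ _ (@IsOpen.preimage _ _ _ t2 _ (cont2 z3) _ hA)
    (@IsOpen.preimage _ _ _ t2 _ (cont2 z3) _ hB)
    ⟨y1, hy1, h3A⟩ ⟨y2, hy2, h3B⟩
  exact ⟨(z3, y3), ⟨hz3, hy3⟩, h4A, h4B⟩

end poly

section chains

variable {V : Type*} (t : TopologicalSpace V)

lemma le_sdim_of_chain {S : Set V} (m : ℕ) (c : ℕ → Set V)
    (hS : ∀ i ≤ m, c i ⊆ S) (hirr : ∀ i ≤ m, @IsIrreducible V t (c i))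
    (hmono : ∀ i < m, c i ⊆ c (i + 1))
    (hstrict : ∀ i < m, ∃ F, IsClosed[t] F ∧ c i ⊆ F ∧ ¬ c (i + 1) ⊆ F) :
    (m : WithBot ℕ∞) ≤ sdim t S := by
  letI := t
  have hirr' : ∀ i ≤ m, IsIrreducible ((↑) ⁻¹' c i : Set S) := by
    intro i hi
    obtain ⟨⟨x, hx⟩, hp⟩ := hirr i hi
    refine ⟨⟨⟨x, hS i hi hx⟩, hx⟩, ?_⟩
    rintro u v hu hv ⟨a, ha, hau⟩ ⟨b, hb, hbv⟩
    obtain ⟨u, hu', rfl⟩ := isOpen_induced_iff.1 hu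
    obtain ⟨v, hv', rfl⟩ := isOpen_induced_iff.1 hv
    obtain ⟨y, hy, hyu, hyv⟩ := hp u v hu' hv' ⟨a, ha, hau⟩ ⟨b, hb, hbv⟩
    exact ⟨⟨y, hS i hi hy⟩, hy, hyu, hyv⟩
  let d : Fin (m + 1) → IrreducibleCloseds S := fun i =>
    ⟨closure ((↑) ⁻¹' c i : Set S), (hirr' i (Nat.lt_succ_iff.1 i.2)).closure, isClosed_closure⟩
  have hd : StrictMono d := by
    rw [Fin.strictMono_iff_lt_succ]
    intro i
    obtain ⟨F, hF, h1, h2⟩ := hstrict i i.2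
    rw [lt_iff_le_not_ge]
    constructor
    · change closure ((↑) ⁻¹' c i : Set S) ⊆ closure ((↑) ⁻¹' c (i + 1) : Set S)
      exact closure_mono (Set.preimage_mono (hmono i i.2))
    · intro h
      replace h : closure ((↑) ⁻¹' c (i + 1) : Set S) ⊆ closure ((↑) ⁻¹' c i : Set S) := h
      apply h2
      intro x hx
      have hx' : (⟨x, hS (i + 1) i.2 hx⟩ : S) ∈ closure ((↑) ⁻¹' c i : Set S) :=
        h (subset_closure hx)
      exact closure_minimal (t := ((↑) ⁻¹' F : Set S)) (Set.preimage_mono h1)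
        (hF.preimage continuous_subtype_val) hx'
  exact Order.LTSeries.length_le_krullDim (LTSeries.mk m d hd)

lemma sdim_le_of_chain {S : Set V} (N : ℕ)
    (H : ∀ (m : ℕ) (c : ℕ → Set V), (∀ i, c i ⊆ S) → (∀ i, @IsIrreducible V t (c i)) →
      Monotone c → (∀ i < m, ∃ F, IsClosed[t] F ∧ c i ⊆ F ∧ ¬ c (i + 1) ⊆ F) → m ≤ N) :
    sdim t S ≤ N := by
  letI := t
  refine iSup_le fun p => ?_
  have key : p.length ≤ N := by
    refine H p.length (fun i => (↑) '' (p ⟨min i p.length, by omega⟩ : Set S)) ?_ ?_ ?_ ?_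
    · rintro i _ ⟨x, _, rfl⟩; exact x.2
    · intro i
      exact (p ⟨min i p.length, by omega⟩).isIrreducible'.image _ continuous_subtype_val.continuousOn
    · intro i j hij
      apply Set.image_mono
      exact p.monotone (a := ⟨min i p.length, by omega⟩) (b := ⟨min j p.length, by omega⟩)
        (by simp [Fin.le_def]; omega)
    · intro i hi
      have hlt : p ⟨min i p.length, by omega⟩ < p ⟨min (i + 1) p.length, by omega⟩ :=
        p.strictMono (by simp [Fin.lt_def]; omega)
      obtain ⟨F, hF, hFe⟩ := isClosed_induced_iff.1 (p ⟨min i p.length, by omega⟩).isClosed'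
      refine ⟨F, hF, ?_, ?_⟩
      · rintro _ ⟨x, hx, rfl⟩
        have : x ∈ (Subtype.val ⁻¹' F : Set S) := by rw [hFe]; exact hx
        exact this
      · intro h
        apply (lt_iff_le_not_ge.1 hlt).2
        intro x hx
        have : x ∈ (Subtype.val ⁻¹' F : Set S) := h ⟨x, hx, rfl⟩
        rw [hFe] at this
        exact this
  exact_mod_cast key

lemma exists_irrComp {Z E : Set V} (hE : @IsIrreducible V t E) (hEZ : E ⊆ Z) :
    ∃ D, IsIrrCompIn t Z D ∧ E ⊆ D := by
  letI := t
  obtain ⟨D, hED, hD⟩ := zorn_subset_nonempty {D : Set V | D ⊆ Z ∧ IsPreirreducible D} (by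
    intro c hc hcc _
    refine ⟨⋃₀ c, ⟨Set.sUnion_subset fun s hs => (hc hs).1, ?_⟩,
      fun s hs => Set.subset_sUnion_of_mem hs⟩
    rintro u v hu hv ⟨y, ⟨p, hpc, hyp⟩, hyu⟩ ⟨x, ⟨q, hqc, hxq⟩, hxv⟩
    rcases hcc.total hpc hqc with hpq | hqp
    · obtain ⟨x, hx, hx'⟩ := (hc hqc).2 u v hu hv ⟨y, hpq hyp, hyu⟩ ⟨x, hxq, hxv⟩
      exact ⟨x, ⟨q, hqc, hx⟩, hx'⟩
    · obtain ⟨x, hx, hx'⟩ := (hc hpc).2 u v hu hv ⟨y, hyp, hyu⟩ ⟨x, hqp hxq, hxv⟩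
      exact ⟨x, ⟨p, hpc, hx⟩, hx'⟩) E ⟨hEZ, hE.2⟩
  refine ⟨D, ⟨hD.prop.1, ⟨hE.1.mono hED, hD.prop.2⟩, fun D' hD' hi hs => ?_⟩, hED⟩
  exact hD.eq_of_subset ⟨hD', hi.2⟩ hs

end chains

section upper

variable {k V M : Type*} [Field k] [AddCommGroup V] [Module k V] [FiniteDimensional k V]
  [AddCommGroup M] [Module k M] [FiniteDimensional k M]

lemma polyFn_surj (k M : Type*) [Field k] [AddCommGroup M] [Module k M] [FiniteDimensional k M] :
    ∃ f : MvPolynomial (Fin (Module.finrank k M)) k →ₐ[k] polyFn k M, Function.Surjective f := by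
  let b := Module.finBasis k M
  let x : Fin (Module.finrank k M) → polyFn k M := fun i => ⟨fun v => b.coord i v, polyFn_lin _⟩
  refine ⟨MvPolynomial.aeval x, ?_⟩
  rw [← AlgHom.range_eq_top, ← Algebra.adjoin_range_eq_range_aeval]
  have hx : Set.range x ⊆ Algebra.adjoin k (Set.range x) := Algebra.subset_adjoin
  rw [eq_top_iff]
  rintro ⟨f, hf⟩ -
  have : f ∈ (Algebra.adjoin k (Set.range x)).map (polyFn k M).val := by
    revert f
    change polyFn k M ≤ _
    refine Algebra.adjoin_le ?_
    intro g hg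
    refine ⟨∑ i, (g (b i)) • x i, ?_, ?_⟩
    · exact sum_mem fun i _ => Subalgebra.smul_mem _ (hx ⟨i, rfl⟩) _
    · ext v
      have h2 : v = ∑ i, b.coord i v • b i := by simp [b.sum_repr]
      have h3 := congrArg (IsLinearMap.mk' g hg) h2
      simp only [map_sum, map_smul, IsLinearMap.mk'_apply, smul_eq_mul] at h3
      rw [h3]
      simp [x, mul_comm]
  obtain ⟨⟨a, ha⟩, ha', rfl⟩ := this
  exact ha'

lemma ringKrullDim_le_of_injective {A : Type*} [CommRing A] [Nontrivial A] [Algebra k A]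
    [Algebra.FiniteType k A] (f : A →ₐ[k] polyFn k M) (hf : Function.Injective f) :
    ringKrullDim A ≤ Module.finrank k M := by
  obtain ⟨s, g, hg, hgint⟩ := exists_integral_inj_algHom_of_fg k A
  obtain ⟨q, hq⟩ := polyFn_surj k M
  have hs : s ≤ Module.finrank k M := by
    have h1 := lift_trdeg_le_of_injective (f.comp g) (hf.comp hg)
    have h2 := lift_trdeg_le_of_surjective q hq
    simp only [MvPolynomial.trdeg_of_isDomain, Cardinal.mk_fin, Cardinal.lift_natCast] at h1 h2
    exact_mod_cast h1.trans h2
  have h1 : ringKrullDim A ≤ ringKrullDim (MvPolynomial (Fin s) k) := by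
    algebraize [g.toRingHom]
    refine Order.krullDim_le_of_strictMono (PrimeSpectrum.comap g.toRingHom) ?_
    intro P Q hPQ
    have : Algebra.IsIntegral (MvPolynomial (Fin s) k) A := ⟨hgint⟩
    exact Ideal.IsIntegral.comap_lt_comap (R := MvPolynomial (Fin s) k) (I := P.asIdeal) (J := Q.asIdeal) hPQ
  refine h1.trans ?_
  simp
  exact_mod_cast hs

lemma sdim_le_of_dominant {f : M → V} (hf : PolyMap k f) {C : Set V}
    (hC : C ⊆ @closure V (zariski k V) (Set.range f)) :
    sdim (zariski k V) C ≤ Module.finrank k M := by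
  letI := zariski k V
  let F : polyFn k V →ₐ[k] polyFn k M :=
    { toFun := fun g => ⟨fun v => g.1 (f v), hf g.1 g.2⟩
      map_one' := rfl
      map_mul' := fun _ _ => rfl
      map_zero' := rfl
      map_add' := fun _ _ => rfl
      commutes' := fun _ => rfl }
  obtain ⟨q, hq⟩ := polyFn_surj k V
  let G := (F.comp q).rangeRestrict
  have hG : Function.Surjective G := AlgHom.rangeRestrict_surjective _
  have hft : Algebra.FiniteType k (F.comp q).range := Algebra.FiniteType.of_surjective G hG
  have hdim := ringKrullDim_le_of_injective (A := (F.comp q).range) (M := M) (F.comp q).range.val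
    Subtype.val_injective
  refine le_trans ?_ hdim
  let J : Set V → Ideal (MvPolynomial (Fin (Module.finrank k V)) k) := fun Z =>
    { carrier := {p | ∀ z ∈ Z, (q p).1 z = 0}
      add_mem' := fun {a b} ha hb z hz => by simp [ha z hz, hb z hz]
      zero_mem' := fun z hz => by simp
      smul_mem' := fun c a ha z hz => by simp [ha z hz] }
  have hJ : ∀ Z p, p ∈ J Z ↔ ∀ z ∈ Z, (q p).1 z = 0 := fun _ _ => Iff.rfl
  have hJprime : ∀ Z, IsIrreducible Z → (J Z).IsPrime := by
    intro Z hZ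
    refine ⟨?_, ?_⟩
    · intro h
      obtain ⟨z, hz⟩ := hZ.1
      have := (hJ Z 1).1 (by rw [h]; trivial) z hz
      simp at this
    · intro a b hab
      by_contra! h
      simp only [hJ, not_forall] at h
      obtain ⟨⟨z, hz, hz'⟩, ⟨w, hw, hw'⟩⟩ := h
      obtain ⟨y, hy, hy1, hy2⟩ := hZ.2 _ _ (zariski_isOpen (q a).2) (zariski_isOpen (q b).2)
        ⟨z, hz, hz'⟩ ⟨w, hw, hw'⟩
      have := (hJ Z _).1 hab y hy
      simp at this
      exact this.elim hy1 hy2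
  have hker : ∀ Z ⊆ C, RingHom.ker G ≤ J Z := by
    intro Z hZ p hp z hz
    have h1 : Set.range f ⊆ {v | (q p).1 v = 0} := by
      rintro _ ⟨y, rfl⟩
      have h2 : G p = 0 := hp
      have h3 : (F (q p)).1 y = 0 := by
        have := congrArg (fun a => a.1.1 y) h2
        exact this
      exact h3
    exact closure_minimal h1 (zariski_isClosed (q p).2) (hC (hZ hz))
  rw [ringKrullDim, ← Order.krullDim_orderDual (α := PrimeSpectrum _)]
  refine Order.krullDim_le_of_strictMono (α := IrreducibleCloseds C) (fun Z => OrderDual.toDual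
    ⟨Ideal.map G (J (Subtype.val '' Z.carrier)), ?_⟩) ?_
  · have := hJprime _ (Z.isIrreducible'.image _ continuous_subtype_val.continuousOn)
    exact Ideal.map_isPrime_of_surjective hG (hker _ (by rintro _ ⟨x, _, rfl⟩; exact x.2))
  · intro Z Y hZY
    have hcm : ∀ Z : IrreducibleCloseds C, Ideal.comap G (Ideal.map G (J (Subtype.val '' Z.carrier)))
        = J (Subtype.val '' Z.carrier) := by
      intro Z
      rw [Ideal.comap_map_of_surjective' _ hG]
      exact sup_eq_left.2 (hker _ (by rintro _ ⟨x, _, rfl⟩; exact x.2))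
    rw [OrderDual.toDual_lt_toDual, lt_iff_le_not_ge]
    constructor
    · change Ideal.map G _ ≤ Ideal.map G _
      refine Ideal.map_mono ?_
      intro p hp z hz
      exact hp z (Set.image_mono hZY.le hz)
    · intro h
      replace h : Ideal.map G (J (Subtype.val '' Z.carrier)) ≤ Ideal.map G (J (Subtype.val '' Y.carrier)) := h
      have h' := Ideal.comap_mono (f := G) h
      rw [hcm, hcm] at h'
      apply (lt_iff_le_not_ge.1 hZY).2
      intro y hy
      by_contra hyZ
      obtain ⟨Fc, hFc, hFe⟩ := isClosed_induced_iff.1 Z.isClosed'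
      have hyF : y.1 ∉ Fc := by
        intro hh
        have : y ∈ (Subtype.val ⁻¹' Fc : Set C) := hh
        rw [hFe] at this
        exact hyZ this
      obtain ⟨g, hg, hg1, hg2⟩ := zariski_closed_sep hFc hyF
      obtain ⟨p, hp⟩ := hq ⟨g, hg⟩
      refine hg2 ?_
      have : p ∈ J (Subtype.val '' Z.carrier) := by
        rintro _ ⟨x, hx, rfl⟩
        rw [hp]
        apply hg1
        rw [← hFe] at hx
        exact hx
      have := h' this y.1 ⟨y, hy, rfl⟩
      rwa [hp] at this

end upper

section triv

variable {k L : Type*} [Field k] [LieRing L] [LieAlgebra k L] [FiniteDimensional k L]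

lemma polyFn_bilin {V W : Type*} [AddCommGroup V] [Module k V] [AddCommGroup W] [Module k W]
    [FiniteDimensional k V] (B : V →ₗ[k] W →ₗ[k] k) :
    (fun p : V × W => B p.1 p.2) ∈ polyFn k (V × W) := by
  let b := Module.finBasis k V
  have : (fun p : V × W => B p.1 p.2) =
      fun p : V × W => ∑ i, (b.coord i ∘ₗ LinearMap.fst k V W) p * (B (b i) ∘ₗ LinearMap.snd k V W) p := by
    ext p
    conv_lhs => rw [← b.sum_repr p.1]
    simp only [map_sum, map_smul, LinearMap.sum_apply, LinearMap.smul_apply, smul_eq_mul]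
    rfl
  rw [this]
  exact polyFn_sum _ fun i _ => polyFn_mul (polyFn_lin _) (polyFn_lin _)

lemma local_triv (n : ℕ) (x₀ : L) (hx₀ : x₀ ∈ grk k L n) :
    ∃ (δ : L → k) (φ : L × L → L) (W : Submodule k L),
      δ ∈ polyFn k L ∧ δ x₀ ≠ 0 ∧ PolyMap k (fun p : L × L => (p.1, φ p)) ∧
      IsCompl (LinearMap.ker (LieAlgebra.ad k L x₀)) W ∧
      (∀ x y, φ (x, y) - δ x • y ∈ W) ∧
      (∀ x, δ x ≠ 0 → n ≤ Module.finrank k (LinearMap.range (LieAlgebra.ad k L x))) ∧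
      (∀ x ∈ grk k L n, δ x ≠ 0 → ∀ y, ⁅x, φ (x, y)⁆ = 0) ∧
      (∀ x y, δ x ≠ 0 → ⁅x, y⁆ = 0 →
        ∃ κ ∈ LinearMap.ker (LieAlgebra.ad k L x₀), φ (x, κ) = y) := by
  obtain ⟨W, hW⟩ := Submodule.exists_isCompl (LinearMap.ker (LieAlgebra.ad k L x₀))
  have hn : Module.finrank k W = n := by
    have h1 := Submodule.finrank_add_eq_of_isCompl hW
    have h2 := LinearMap.finrank_range_add_finrank_ker (LieAlgebra.ad k L x₀)
    have h3 : Module.finrank k (LinearMap.range (LieAlgebra.ad k L x₀)) = n := hx₀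
    omega
  let bW := Module.finBasisOfFinrankEq k W hn
  let e : (Fin n → k) →ₗ[k] L := W.subtype ∘ₗ bW.equivFun.symm.toLinearMap
  have heW : ∀ w, e w ∈ W := fun w => (bW.equivFun.symm w).2
  have hWe : ∀ y ∈ W, ∃ w, e w = y := fun y hy =>
    ⟨bW.equivFun ⟨y, hy⟩, by simp [e, -Module.Basis.equivFun_apply]⟩
  have hinj : LinearMap.ker (LieAlgebra.ad k L x₀ ∘ₗ e) = ⊥ := by
    rw [LinearMap.ker_eq_bot']
    intro w hw
    have h1 : e w ∈ LinearMap.ker (LieAlgebra.ad k L x₀) := hw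
    have h2 : e w = 0 := Submodule.disjoint_def.1 hW.disjoint _ h1 (heW w)
    have h3 : bW.equivFun.symm w = 0 := Subtype.ext h2
    exact bW.equivFun.symm.map_eq_zero_iff.1 h3
  obtain ⟨s, hs⟩ := LinearMap.exists_leftInverse_of_injective _ hinj
  let M : L → Matrix (Fin n) (Fin n) k := fun x =>
    LinearMap.toMatrix' (s ∘ₗ (LieAlgebra.ad k L x : L →ₗ[k] L) ∘ₗ e)
  have hM : ∀ x w, (M x).mulVec w = s ⁅x, e w⁆ := by
    intro x w
    simp [M, LinearMap.toMatrix'_mulVec]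
  have hMpoly : ∀ i j, (fun x => M x i j) ∈ polyFn k L := by
    intro i j
    have : (fun x => M x i j) = fun x => ((LinearMap.proj i ∘ₗ s) ∘ₗ
        ((LieAlgebra.ad k L : L →ₗ[k] Module.End k L).flip (e (Pi.single j 1)))) x := by
      ext x
      simp [M, LinearMap.toMatrix'_apply]
    rw [this]
    exact polyFn_lin _
  have hadj1 : ∀ x v, (M x).mulVec ((M x).adjugate.mulVec v) = (M x).det • v := by
    intro x v
    rw [Matrix.mulVec_mulVec, Matrix.mul_adjugate, Matrix.smul_mulVec, Matrix.one_mulVec]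
  have hadj2 : ∀ x v, (M x).adjugate.mulVec ((M x).mulVec v) = (M x).det • v := by
    intro x v
    rw [Matrix.mulVec_mulVec, Matrix.adjugate_mul, Matrix.smul_mulVec, Matrix.one_mulVec]
  have hTe : ∀ x, (M x).det ≠ 0 → Function.Injective ((LieAlgebra.ad k L x : L →ₗ[k] L) ∘ₗ e) := by
    intro x hx
    rw [← LinearMap.ker_eq_bot, LinearMap.ker_eq_bot']
    intro w hw
    have h1 : (M x).mulVec w = 0 := by
      rw [hM]
      have : ⁅x, e w⁆ = 0 := hw
      rw [this, map_zero]
    have h2 := hadj2 x w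
    rw [h1, Matrix.mulVec_zero] at h2
    exact (smul_eq_zero.1 h2.symm).resolve_left hx
  have hle : ∀ x, LinearMap.range ((LieAlgebra.ad k L x : L →ₗ[k] L) ∘ₗ e) ≤
      LinearMap.range (LieAlgebra.ad k L x) := fun x => LinearMap.range_comp_le_range _ _
  have hfr : ∀ x, (M x).det ≠ 0 →
      Module.finrank k (LinearMap.range ((LieAlgebra.ad k L x : L →ₗ[k] L) ∘ₗ e)) = n := by
    intro x hx
    rw [LinearMap.finrank_range_of_inj (hTe x hx)]
    simp
  refine ⟨fun x => (M x).det, fun p => (M p.1).det • p.2 - e ((M p.1).adjugate.mulVec (s ⁅p.1, p.2⁆)),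
    W, polyFn_det hMpoly, ?_, ?_, hW, ?_, ?_, ?_, ?_⟩
  · have : M x₀ = 1 := by
      have h1 : s ∘ₗ (LieAlgebra.ad k L x₀ : L →ₗ[k] L) ∘ₗ e = LinearMap.id := hs
      simp only [M, h1, LinearMap.toMatrix'_id]
    simp [this]
  · have hfst : PolyMap k (fun p : L × L => p.1) := polyMap_linear (LinearMap.fst k L L)
    refine polyMap_of_lin fun g => ?_
    have : (fun p : L × L => g (p.1, (M p.1).det • p.2 - e ((M p.1).adjugate.mulVec (s ⁅p.1, p.2⁆)))) =
        fun p => ((g ∘ₗ LinearMap.inl k L L) ∘ₗ LinearMap.fst k L L) p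
          + ((M p.1).det * ((g ∘ₗ LinearMap.inr k L L) ∘ₗ LinearMap.snd k L L) p
          - ∑ i, (∑ j, (M p.1).adjugate i j *
            (((LieAlgebra.ad k L : L →ₗ[k] Module.End k L).compr₂ (LinearMap.proj j ∘ₗ s)) p.1 p.2))
              * g (0, e (Pi.single i 1))) := by
      ext p
      have hg : ∀ a b, g (a, b) = g (a, 0) + g (0, b) := fun a b => by
        rw [← map_add]; simp
      have hge : ∀ v : Fin n → k, g (0, e v) = ∑ i, v i * g (0, e (Pi.single i 1)) := by
        intro v
        have h1 : g (0, e v) = (g ∘ₗ LinearMap.inr k L L ∘ₗ e) v := rfl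
        rw [h1, LinearMap.pi_apply_eq_sum_univ]
        refine Finset.sum_congr rfl fun i _ => ?_
        have : (fun j => if i = j then (1 : k) else 0) = Pi.single i 1 := by
          ext j; simp [Pi.single_apply, eq_comm]
        rw [this]
        rfl
      have hsm : ∀ (c : k) b b', g (0, c • b - b') = c * g (0, b) - g (0, b') := by
        intro c b b'
        rw [← smul_eq_mul, ← map_smul, ← map_sub]; simp
      rw [hg, hsm, hge]
      rfl
    rw [this]
    refine polyFn_add (polyFn_lin _) (polyFn_sub (polyFn_mul (hfst _ (polyFn_det hMpoly))
      (polyFn_lin _)) (polyFn_sum _ fun i _ => polyFn_mul (polyFn_sum _ fun j _ =>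
        polyFn_mul (hfst _ (polyFn_adjugate hMpoly i j)) (polyFn_bilin _)) (polyFn_const _)))
  · intro x y
    simp only [sub_sub_cancel_left]
    exact W.neg_mem (heW _)
  · intro x hx
    rw [← hfr x hx]
    exact Submodule.finrank_mono (hle x)
  · intro x hxn hx y
    have heq := Submodule.eq_of_le_of_finrank_eq (hle x) ((hfr x hx).trans (Eq.symm hxn))
    dsimp only
    set z := (M x).det • y - e ((M x).adjugate.mulVec (s ⁅x, y⁆)) with hz
    have h1 : s ⁅x, z⁆ = 0 := by
      rw [hz, lie_sub, map_sub, ← hM, hadj1, lie_smul, map_smul, sub_self]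
    have h2 : ⁅x, z⁆ ∈ LinearMap.range ((LieAlgebra.ad k L x : L →ₗ[k] L) ∘ₗ e) := by
      rw [heq]; exact ⟨z, rfl⟩
    obtain ⟨w, hw⟩ := h2
    have hw' : ⁅x, e w⁆ = ⁅x, z⁆ := hw
    rw [← hw', ← hM] at h1
    have h3 := hadj2 x w
    rw [h1, Matrix.mulVec_zero] at h3
    have := (smul_eq_zero.1 h3.symm).resolve_left hx
    rw [← hw', this, map_zero, lie_zero]
  · intro x y hx hxy
    have : y ∈ LinearMap.ker (LieAlgebra.ad k L x₀) ⊔ W := by rw [hW.sup_eq_top]; trivial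
    obtain ⟨κ, hκ, w', hw', rfl⟩ := Submodule.mem_sup.1 this
    obtain ⟨w, rfl⟩ := hWe w' hw'
    refine ⟨((M x).det)⁻¹ • κ, Submodule.smul_mem _ _ hκ, ?_⟩
    have h1 : ⁅x, κ⁆ = -⁅x, e w⁆ := by
      rw [lie_add] at hxy
      exact eq_neg_of_add_eq_zero_left hxy
    dsimp only
    rw [smul_inv_smul₀ hx, lie_smul, h1, map_smul, map_neg, ← hM, Matrix.mulVec_smul,
      Matrix.mulVec_neg, hadj2, smul_neg, inv_smul_smul₀ hx, map_neg, sub_neg_eq_add]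

lemma exists_flag (K : Submodule k L) : ∃ Kf : ℕ → Submodule k L, Monotone Kf ∧ (∀ j, Kf j ≤ K) ∧
    (∀ j < Module.finrank k K, ∃ x ∈ Kf (j + 1), x ∉ Kf j) := by
  let b := Module.finBasis k K
  refine ⟨fun j => (b.flag ⟨min j (Module.finrank k K), by omega⟩).map K.subtype, ?_, ?_, ?_⟩
  · intro i j hij
    refine Submodule.map_mono (b.flag_mono ?_)
    simp [Fin.le_def]; omega
  · intro j
    exact Submodule.map_subtype_le _ _
  · intro j hj
    have : b.flag ⟨min j (Module.finrank k K), by omega⟩ <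
        b.flag ⟨min (j + 1) (Module.finrank k K), by omega⟩ :=
      b.flag_strictMono (by simp [Fin.lt_def]; omega)
    obtain ⟨x, hx1, hx2⟩ := SetLike.exists_of_lt this
    refine ⟨x.1, ⟨x, hx1, rfl⟩, ?_⟩
    rintro ⟨y, hy, hyx⟩
    exact hx2 (by rwa [← Subtype.ext hyx])

end triv

section main

variable {k L : Type*} [Field k] [Infinite k] [LieRing L] [LieAlgebra k L] [FiniteDimensional k L]

lemma component_upper (n₀ : ℕ) (x₀ : L) (hx₀ : x₀ ∈ grk k L n₀)
    (h2 : ∀ n : ℕ, (grk k L n).Nonempty → n ≤ n₀) :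
    ∃ N : Set (L × L), IsIrrCompIn (zariski k (L × L)) (commSet L) N ∧
      sdim (zariski k (L × L)) N ≤
        ((Module.finrank k L + (Module.finrank k L - n₀) : ℕ) : WithBot ℕ∞) := by
  letI t1 := zariski k L
  letI t2 := zariski k (L × L)
  obtain ⟨δ, φ, W, hδ, hδ0, hφ, hW, hφW, hδn, hφ0, hsurj⟩ := local_triv n₀ x₀ hx₀
  have hgrk : ∀ x, δ x ≠ 0 → x ∈ grk k L n₀ := fun x hx =>
    le_antisymm (h2 _ ⟨x, rfl⟩) (hδn x hx)
  have hOirr : @IsIrreducible L t1 {x | δ x ≠ 0} := by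
    have h := zariski_affine_irred (k := k) (0 : L) ⊤
    simp only [Submodule.mem_top] at h
    exact h.2.subset_irreducible ⟨x₀, hδ0⟩ (zariski_isOpen hδ) (fun _ => id) (fun _ _ => trivial)
  have hE := @IsIrreducible.image _ _ t2 t2 _ (zariski_prod_irred hOirr
    (LinearMap.ker (LieAlgebra.ad k L x₀))) _ (@Continuous.continuousOn _ _ t2 t2 _ _ hφ.continuous)
  obtain ⟨N, hN, hEN⟩ := exists_irrComp t2 hE (Z := commSet L) (by
    rintro _ ⟨⟨x, y⟩, ⟨hx, hy⟩, rfl⟩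
    exact hφ0 x (hgrk x hx) hx y)
  refine ⟨N, hN, ?_⟩
  let ι : (L × LinearMap.ker (LieAlgebra.ad k L x₀)) →ₗ[k] L × L :=
    LinearMap.prodMap LinearMap.id (Submodule.subtype _)
  have hf : PolyMap k (fun p : L × LinearMap.ker (LieAlgebra.ad k L x₀) =>
      ((ι p).1, φ (ι p))) := PolyMap.comp hφ (polyMap_linear ι)
  have hfin : Module.finrank k (L × LinearMap.ker (LieAlgebra.ad k L x₀)) =
      Module.finrank k L + (Module.finrank k L - n₀) := by
    rw [Module.finrank_prod]
    have h2 := LinearMap.finrank_range_add_finrank_ker (LieAlgebra.ad k L x₀)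
    have h3 : Module.finrank k (LinearMap.range (LieAlgebra.ad k L x₀)) = n₀ := hx₀
    omega
  rw [← hfin]
  refine sdim_le_of_dominant hf ?_
  intro p hp
  rw [@mem_closure_iff _ t2]
  intro U hU hpU
  have hfst : PolyMap k (fun p : L × L => p.1) := polyMap_linear (LinearMap.fst k L L)
  have hO : IsOpen[t2] {p : L × L | δ p.1 ≠ 0} := zariski_isOpen (hfst _ hδ)
  obtain ⟨⟨x, y⟩, hqN, hqU, hqO⟩ := hN.2.1.2 U _ hU hO ⟨p, hp, hpU⟩
    ⟨(x₀, φ (x₀, 0)), hEN ⟨(x₀, 0), ⟨hδ0, Submodule.zero_mem _⟩, rfl⟩, hδ0⟩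
  obtain ⟨κ, hκ, hκy⟩ := hsurj x y hqO (hN.1 hqN)
  refine ⟨(x, y), hqU, ⟨(x, ⟨κ, hκ⟩), ?_⟩⟩
  simp [ι, hκy]

lemma component_lower (n m : ℕ) (c : ℕ → Set L) (hc : ∀ i, c i ⊆ grk k L n)
    (hirr : ∀ i, @IsIrreducible L (zariski k L) (c i)) (hmono : Monotone c)
    (hstrict : ∀ i < m, ∃ F, IsClosed[zariski k L] F ∧ c i ⊆ F ∧ ¬ c (i + 1) ⊆ F) :
    ∃ D : Set (L × L), IsIrrCompIn (zariski k (L × L)) (commSet L) D ∧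
      ((m + (Module.finrank k L - n) : ℕ) : WithBot ℕ∞) ≤ sdim (zariski k (L × L)) D := by
  letI t1 := zariski k L
  letI t2 := zariski k (L × L)
  obtain ⟨x₀, hx₀c⟩ := (hirr 0).1
  have hx₀ := hc 0 hx₀c
  obtain ⟨δ, φ, W, hδ, hδ0, hφ, hW, hφW, hδn, hφ0, hsurj⟩ := local_triv n x₀ hx₀
  obtain ⟨Kf, hKm, hKK, hKs⟩ := exists_flag (LinearMap.ker (LieAlgebra.ad k L x₀))
  have hfin : Module.finrank k (LinearMap.ker (LieAlgebra.ad k L x₀)) = Module.finrank k L - n := by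
    have h2 := LinearMap.finrank_range_add_finrank_ker (LieAlgebra.ad k L x₀)
    have h3 : Module.finrank k (LinearMap.range (LieAlgebra.ad k L x₀)) = n := hx₀
    omega
  rw [hfin] at hKs
  have hx₀i : ∀ i, x₀ ∈ c i := fun i => hmono (Nat.zero_le i) hx₀c
  have hO : IsOpen {x | δ x ≠ 0} := zariski_isOpen hδ
  have hcO : ∀ i, IsIrreducible (c i ∩ {x | δ x ≠ 0}) := by
    intro i
    refine ⟨⟨x₀, hx₀i i, hδ0⟩, ?_⟩
    rintro u v hu hv ⟨a, ⟨ha, haO⟩, hau⟩ ⟨b, ⟨hb, hbO⟩, hbv⟩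
    obtain ⟨y, hy, hy1, hy2⟩ := (hirr i).2 _ _ (hu.inter hO) (hv.inter hO)
      ⟨a, ha, hau, haO⟩ ⟨b, hb, hbv, hbO⟩
    exact ⟨y, ⟨hy, hy1.2⟩, hy1.1, hy2.1⟩
  let E : ℕ → Set (L × L) := fun i => (fun p : L × L => (p.1, φ p)) ''
    ((c (min i m) ∩ {x | δ x ≠ 0}) ×ˢ (Kf (i - m) : Set L))
  have hEirr : ∀ i, @IsIrreducible _ t2 (E i) := fun i =>
    @IsIrreducible.image _ _ t2 t2 _ (zariski_prod_irred (hcO _) (Kf (i - m))) _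
      (@Continuous.continuousOn _ _ t2 t2 _ _ hφ.continuous)
  have hEmono : Monotone E := by
    intro i j hij
    refine Set.image_mono (Set.prod_mono (Set.inter_subset_inter_left _ (hmono ?_)) (hKm ?_)) <;> omega
  obtain ⟨D, hD, hED⟩ := exists_irrComp t2 (hEirr (m + (Module.finrank k L - n))) (Z := commSet L) (by
    rintro _ ⟨⟨x, y⟩, ⟨⟨hx, hxO⟩, hy⟩, rfl⟩
    exact hφ0 x (hc _ hx) hxO y)
  refine ⟨D, hD, ?_⟩
  refine le_sdim_of_chain t2 _ E (fun i hi => (hEmono hi).trans hED) (fun i _ => hEirr i)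
    (fun i _ => hEmono (Nat.le_succ i)) ?_
  intro i hi
  by_cases him : i < m
  · obtain ⟨F, hF, h1, h2⟩ := hstrict i him
    have hfst : PolyMap k (fun p : L × L => p.1) := polyMap_linear (LinearMap.fst k L L)
    refine ⟨(fun p : L × L => p.1) ⁻¹' F, @IsClosed.preimage _ _ t2 t1 _ hfst.continuous _ hF, ?_, ?_⟩
    · rintro _ ⟨⟨x, y⟩, ⟨⟨hx, hxO⟩, hy⟩, rfl⟩
      rw [min_eq_left him.le] at hx
      exact h1 hx
    · intro h
      obtain ⟨z, hz, hzF⟩ := Set.not_subset.1 h2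
      obtain ⟨w, hw, hwF, hwO⟩ := (hirr (i + 1)).2 _ _ hF.isOpen_compl hO ⟨z, hz, hzF⟩
        ⟨x₀, hx₀i _, hδ0⟩
      refine hwF (h ⟨(w, 0), ⟨⟨?_, hwO⟩, Submodule.zero_mem _⟩, rfl⟩)
      rwa [min_eq_left (Nat.succ_le_of_lt him)]
  · have hsnd : PolyMap k (fun p : L × L => p.2) := polyMap_linear (LinearMap.snd k L L)
    obtain ⟨κ, hκ1, hκ2⟩ := hKs (i - m) (by omega)
    refine ⟨(fun p : L × L => p.2) ⁻¹' (Kf (i - m) ⊔ W : Submodule k L),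
      @IsClosed.preimage _ _ t2 t1 _ hsnd.continuous _ (zariski_submodule_closed _), ?_, ?_⟩
    · rintro _ ⟨⟨x, y⟩, ⟨⟨hx, hxO⟩, hy⟩, rfl⟩
      change φ (x, y) ∈ Kf (i - m) ⊔ W
      have : φ (x, y) = δ x • y + (φ (x, y) - δ x • y) := by abel
      rw [this]
      exact Submodule.add_mem_sup (Submodule.smul_mem _ _ hy) (hφW x y)
    · intro h
      have h1 : φ (x₀, κ) ∈ Kf (i - m) ⊔ W := h ⟨(x₀, κ), ⟨⟨hx₀i _, hδ0⟩, by
        rw [Nat.sub_add_comm (by omega)]; exact hκ1⟩, rfl⟩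
      have h2 : δ x₀ • κ ∈ Kf (i - m) ⊔ W := by
        have : δ x₀ • κ = φ (x₀, κ) - (φ (x₀, κ) - δ x₀ • κ) := by abel
        rw [this]
        exact Submodule.sub_mem _ h1 (Submodule.mem_sup_right (hφW x₀ κ))
      have h3 : κ ∈ Kf (i - m) ⊔ W := (Submodule.smul_mem_iff _ hδ0).1 h2
      obtain ⟨a, ha, w, hw, haw⟩ := Submodule.mem_sup.1 h3
      have hwK : w ∈ LinearMap.ker (LieAlgebra.ad k L x₀) := by
        have : w = κ - a := by rw [← haw]; abel
        rw [this]
        exact Submodule.sub_mem _ (hKK _ hκ1) (hKK _ ha)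
      have hw0 := Submodule.disjoint_def.1 hW.disjoint _ hwK hw
      rw [hw0, add_zero] at haw
      exact hκ2 (haw ▸ ha)

lemma open_lower (n₀ : ℕ) (x₀ : L) (hx₀ : x₀ ∈ grk k L n₀)
    (h2 : ∀ n : ℕ, (grk k L n).Nonempty → n ≤ n₀) :
    (Module.finrank k L : WithBot ℕ∞) ≤ sdim (zariski k L) (grk k L n₀) := by
  letI t1 := zariski k L
  obtain ⟨δ, φ, W, hδ, hδ0, hφ, hW, hφW, hδn, hφ0, hsurj⟩ := local_triv n₀ x₀ hx₀
  have hgrk : ∀ x, δ x ≠ 0 → x ∈ grk k L n₀ := fun x hx =>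
    le_antisymm (h2 _ ⟨x, rfl⟩) (hδn x hx)
  have hO : IsOpen {x | δ x ≠ 0} := zariski_isOpen hδ
  obtain ⟨Kf, hKm, -, hKs⟩ := exists_flag (⊤ : Submodule k L)
  rw [finrank_top] at hKs
  have hAirr : ∀ j, IsIrreducible {v | v - x₀ ∈ Kf j} := fun j => zariski_affine_irred x₀ (Kf j)
  refine le_sdim_of_chain t1 _ (fun j => {v | v - x₀ ∈ Kf j} ∩ {x | δ x ≠ 0})
    (fun j _ x hx => hgrk x hx.2) ?_ ?_ ?_
  · intro j _
    refine ⟨⟨x₀, by simp, hδ0⟩, ?_⟩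
    rintro u v hu hv ⟨a, ⟨ha, haO⟩, hau⟩ ⟨b, ⟨hb, hbO⟩, hbv⟩
    obtain ⟨y, hy, hy1, hy2⟩ := (hAirr j).2 _ _ (hu.inter hO) (hv.inter hO)
      ⟨a, ha, hau, haO⟩ ⟨b, hb, hbv, hbO⟩
    exact ⟨y, ⟨hy, hy1.2⟩, hy1.1, hy2.1⟩
  · intro j _
    exact Set.inter_subset_inter_left _ fun v hv => hKm (Nat.le_succ j) hv
  · intro j hj
    obtain ⟨κ, hκ1, hκ2⟩ := hKs j hj
    have hcl : IsClosed {v | v - x₀ ∈ Kf j} := by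
      have hp : PolyMap k (fun v : L => v - x₀) := by
        have := polyMap_affine (k := k) (-x₀) (LinearMap.id : L →ₗ[k] L)
        simpa [neg_add_eq_sub] using this
      exact (zariski_submodule_closed (Kf j)).preimage hp.continuous
    refine ⟨_, hcl, Set.inter_subset_left, fun h => ?_⟩
    obtain ⟨w, hw, hwF, hwO⟩ := (hAirr (j + 1)).2 _ _ hcl.isOpen_compl hO
      ⟨x₀ + κ, by simpa using hκ1, by simpa using hκ2⟩ ⟨x₀, by simp, hδ0⟩
    exact hwF (h ⟨hw, hwO⟩)

end main

/-- if `C₂(𝔤)` is equidimensional, then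
`mod(𝔤) = dim_k 𝔤 − n₀` where `n₀ = max{n : 𝔤₍ₙ₎ ≠ ∅}`.  The equality
`mod(𝔤) = dim_k 𝔤 − n₀` is expressed by saying that `dim_k 𝔤 − n₀` realizes the
maximum defining `mod(𝔤)`. -/
theorem mod_eq_of_equidimensional (k L : Type*) [Field k] [IsAlgClosed k]
    [LieRing L] [LieAlgebra k L] [Module.Finite k L]
    (n₀ : ℕ) (h1 : (grk k L n₀).Nonempty) (h2 : ∀ n : ℕ, (grk k L n).Nonempty → n ≤ n₀)
    (hequi : ∀ C D : Set (L × L),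
      IsIrrCompIn (zariski k (L × L)) (commSet L) C →
      IsIrrCompIn (zariski k (L × L)) (commSet L) D →
      sdim (zariski k (L × L)) C = sdim (zariski k (L × L)) D) :
    (∀ n : ℕ, (grk k L n).Nonempty →
      sdim (zariski k L) (grk k L n) ≤ ((Module.finrank k L - n₀ + n : ℕ) : WithBot ℕ∞)) ∧
    (∃ n : ℕ, (grk k L n).Nonempty ∧
      sdim (zariski k L) (grk k L n) = ((Module.finrank k L - n₀ + n : ℕ) : WithBot ℕ∞)) := by
  have hinf : Infinite k := IsAlgClosed.instInfinite
  obtain ⟨x₀, hx₀⟩ := h1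
  obtain ⟨N, hN1, hN2⟩ := component_upper n₀ x₀ hx₀ h2
  have hn₀ : n₀ ≤ Module.finrank k L := hx₀ ▸ Submodule.finrank_le _
  have hpart : ∀ n : ℕ, (grk k L n).Nonempty →
      sdim (zariski k L) (grk k L n) ≤ ((Module.finrank k L - n₀ + n : ℕ) : WithBot ℕ∞) := by
    intro n hn
    refine sdim_le_of_chain _ _ fun m c hc hirr hmono hstrict => ?_
    obtain ⟨D, hD, hle⟩ := component_lower n m c hc hirr hmono hstrict
    have h3 := hle.trans ((hequi D N hD hN1).le.trans hN2)
    have h4 : m + (Module.finrank k L - n) ≤ Module.finrank k L + (Module.finrank k L - n₀) := by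
      exact_mod_cast h3
    obtain ⟨x, hx⟩ := hn
    have : n ≤ Module.finrank k L := hx ▸ Submodule.finrank_le _
    omega
  refine ⟨hpart, n₀, ⟨x₀, hx₀⟩, le_antisymm (hpart n₀ ⟨x₀, hx₀⟩) ?_⟩
  rw [Nat.sub_add_cancel hn₀]
  exact open_lower n₀ x₀ hx₀ h2
end

section
/- Let 𝔤 be a finite-dimensional Lie algebra. If the commuting variety C₂(𝔤) is irreducible, then for n with 𝔤₍ₙ₎ nonempty, the equality dim 𝔤₍ₙ₎ − n = mod(𝔤) holds if and only if n = max{m : 𝔤₍ₘ₎ ≠ ∅}. -/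
/-! ### Krull dimension versus transcendence degree -/

theorem aux_trdeg_succ_le {k : Type*} [Field k] {A B : Type*} [CommRing A] [IsDomain A]
    [CommRing B] [IsDomain B] [Algebra k A] [Algebra k B] (f : A →ₐ[k] B)
    (hf : Function.Surjective f) (a : A) (ha : a ≠ 0) (hfa : f a = 0) (N : ℕ)
    (hN : Algebra.trdeg k A ≤ (N : Cardinal)) :
    ∃ N' : ℕ, N = N' + 1 ∧ Algebra.trdeg k B ≤ (N' : Cardinal) := by
  obtain ⟨s, hs⟩ := exists_isTranscendenceBasis k B
  choose g hg using hf
  have hy : AlgebraicIndependent k (fun i : s => g i) := by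
    apply AlgebraicIndependent.of_comp f
    have e : (f ∘ fun i : s => g i) = Subtype.val := funext fun i => hg _
    rw [e]
    exact hs.1
  have hinj : ∀ r ∈ Algebra.adjoin k (Set.range (fun i : s => g i)), f r = 0 → r = 0 := by
    intro r hr h0
    rw [Algebra.adjoin_range_eq_range_aeval] at hr
    obtain ⟨p, rfl⟩ := hr
    have h1 : MvPolynomial.aeval (fun i : s => (i : B)) p = 0 := by
      have e : f (MvPolynomial.aeval (fun i : s => g i) p) = 0 := h0
      rw [← AlgHom.comp_apply, MvPolynomial.comp_aeval] at e
      simpa [hg] using e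
    have h2 : p = 0 := by
      apply hs.1
      rw [map_zero]
      exact h1
    simp [h2]
  have htr : Transcendental (Algebra.adjoin k (Set.range (fun i : s => g i))) a := by
    intro halg
    obtain ⟨r, hr, b, hb⟩ := halg.exists_nonzero_dvd (mem_nonZeroDivisors_of_ne_zero ha)
    apply hr
    apply Subtype.ext
    apply hinj r.1 r.2
    have : (r : A) = a * b := hb
    rw [this, map_mul, hfa, zero_mul]
  have hopt := (hy.option_iff_transcendental a).2 htr
  have hc := hopt.lift_cardinalMk_le_trdeg
  rw [Cardinal.mk_option, hs.cardinalMk_eq_trdeg] at hc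
  have hc2 := hc.trans (Cardinal.lift_le.2 hN)
  rw [Cardinal.lift_add, Cardinal.lift_one, Cardinal.lift_natCast] at hc2
  have hfin : Algebra.trdeg k B < Cardinal.aleph0 := by
    rw [← Cardinal.lift_lt_aleph0]
    exact (self_le_add_right _ _).trans_lt (hc2.trans_lt (Cardinal.natCast_lt_aleph0))
  obtain ⟨M, hM⟩ := Cardinal.lt_aleph0.1 hfin
  rw [hM, Cardinal.lift_natCast] at hc2
  have hc3 : M + 1 ≤ N := by exact_mod_cast hc2
  refine ⟨N - 1, by omega, ?_⟩
  rw [hM]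
  exact_mod_cast (by omega : M ≤ N - 1)

theorem aux_coheight_le {k A : Type*} [Field k] [CommRing A] [Algebra k A] (N : ℕ) :
    ∀ p : PrimeSpectrum A, Algebra.trdeg k (A ⧸ p.asIdeal) ≤ (N : Cardinal) →
      Order.coheight p ≤ N := by
  induction N with
  | zero =>
    intro p hp
    rw [Order.coheight_le_coe_iff]
    intro q hq
    exfalso
    obtain ⟨a, ha, hna⟩ := SetLike.exists_of_lt (show p.asIdeal < q.asIdeal from hq)
    obtain ⟨N', h, -⟩ := aux_trdeg_succ_le
      (Ideal.Quotient.factorₐ k (show p.asIdeal ≤ q.asIdeal from hq.le))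
      (Ideal.Quotient.factor_surjective (show p.asIdeal ≤ q.asIdeal from hq.le)) (Ideal.Quotient.mk _ a)
      (by rwa [Ne, Ideal.Quotient.eq_zero_iff_mem])
      (by simpa [Ideal.Quotient.eq_zero_iff_mem] using ha) 0 hp
    omega
  | succ N ih =>
    intro p hp
    rw [Order.coheight_le_coe_iff]
    intro q hq
    obtain ⟨a, ha, hna⟩ := SetLike.exists_of_lt (show p.asIdeal < q.asIdeal from hq)
    obtain ⟨N', h, h'⟩ := aux_trdeg_succ_le
      (Ideal.Quotient.factorₐ k (show p.asIdeal ≤ q.asIdeal from hq.le))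
      (Ideal.Quotient.factor_surjective (show p.asIdeal ≤ q.asIdeal from hq.le)) (Ideal.Quotient.mk _ a)
      (by rwa [Ne, Ideal.Quotient.eq_zero_iff_mem])
      (by simpa [Ideal.Quotient.eq_zero_iff_mem] using ha) (N + 1) hp
    obtain rfl : N = N' := by omega
    refine (ih q h').trans_lt ?_
    exact_mod_cast Nat.lt_succ_self N

/-! ### Regular functions -/

/-- The algebra of regular functions. -/
noncomputable def reg (k V : Type*) [CommRing k] [AddCommGroup V] [Module k V] :
    Subalgebra k (V → k) := Algebra.adjoin k {g : V → k | IsLinearMap k g}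

section regs
variable {k V V' : Type*} [Field k] [AddCommGroup V] [Module k V] [AddCommGroup V'] [Module k V']

theorem linear_mem_reg (g : V →ₗ[k] k) : (fun v => g v) ∈ reg k V :=
  Algebra.subset_adjoin g.isLinear

theorem comp_mem_reg (φ : V → V') (hφ : ∀ g : V' →ₗ[k] k, (fun v => g (φ v)) ∈ reg k V)
    (f : V' → k) (hf : f ∈ reg k V') : (fun v => f (φ v)) ∈ reg k V := by
  induction hf using Algebra.adjoin_induction with
  | mem x hx => exact hφ (IsLinearMap.mk' x hx)
  | algebraMap r => exact (reg k V).algebraMap_mem r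
  | add x y _ _ hx hy => exact (reg k V).add_mem hx hy
  | mul x y _ _ hx hy => exact (reg k V).mul_mem hx hy

theorem reg_line (f : V → k) (hf : f ∈ reg k V) (a b : V) :
    ∃ F : Polynomial k, ∀ t : k, f (a + t • b) = F.eval t := by
  induction hf using Algebra.adjoin_induction with
  | mem x hx =>
    refine ⟨Polynomial.C (x a) + Polynomial.X * Polynomial.C (x b), fun t => ?_⟩
    rw [hx.map_add, hx.map_smul]; simp; ring
  | algebraMap r => exact ⟨Polynomial.C r, fun t => by simp⟩
  | add x y _ _ hx hy =>
    obtain ⟨F, hF⟩ := hx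
    obtain ⟨G, hG⟩ := hy
    exact ⟨F + G, fun t => by simp [hF, hG]⟩
  | mul x y _ _ hx hy =>
    obtain ⟨F, hF⟩ := hx
    obtain ⟨G, hG⟩ := hy
    exact ⟨F * G, fun t => by simp [hF, hG]⟩

/-- On a translate of a linear subspace the product of two nonzero functions is nonzero. -/
theorem reg_affine [Infinite k] (f g : V → k) (hf : f ∈ reg k V) (hg : g ∈ reg k V)
    (v : V) (K : Submodule k V) (a b : V) (ha : a ∈ K) (hb : b ∈ K)
    (hfa : f (v + a) ≠ 0) (hgb : g (v + b) ≠ 0) :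
    ∃ c ∈ K, f (v + c) ≠ 0 ∧ g (v + c) ≠ 0 := by
  by_contra! H
  obtain ⟨F, hF⟩ := reg_line f hf (v + a) (b - a)
  obtain ⟨G, hG⟩ := reg_line g hg (v + a) (b - a)
  have h0 : F * G = 0 := by
    apply Polynomial.funext
    intro t
    rw [Polynomial.eval_mul, ← hF, ← hG, Polynomial.eval_zero, mul_eq_zero]
    have := H (a + t • (b - a)) (K.add_mem ha (K.smul_mem _ (K.sub_mem hb ha)))
    rw [← add_assoc] at this
    tauto
  rcases mul_eq_zero.mp h0 with h | h
  · apply hfa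
    have := hF 0
    rw [h] at this; simpa using this
  · apply hgb
    have := hG 1
    rw [h] at this; simpa using this

theorem exists_reg_of_isOpen (U : Set V) (hU : @IsOpen _ (zariski k V) U) (x : V) (hx : x ∈ U) :
    ∃ f ∈ reg k V, f x ≠ 0 ∧ ∀ y, f y ≠ 0 → y ∈ U := by
  induction hU with
  | basic s hs =>
    obtain ⟨f, hf, rfl⟩ := hs
    exact ⟨f, hf, hx, fun y hy => hy⟩
  | univ => exact ⟨1, (reg k V).one_mem, one_ne_zero, fun _ _ => trivial⟩
  | inter s t _ _ hs ht =>
    obtain ⟨f, hf, h1, h2⟩ := hs hx.1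
    obtain ⟨g, hg, h3, h4⟩ := ht hx.2
    exact ⟨f * g, (reg k V).mul_mem hf hg, mul_ne_zero h1 h3, fun y hy =>
      ⟨h2 y (left_ne_zero_of_mul hy), h4 y (right_ne_zero_of_mul hy)⟩⟩
  | sUnion S _ ih =>
    obtain ⟨s, hs, hxs⟩ := hx
    obtain ⟨f, hf, h1, h2⟩ := ih s hs hxs
    exact ⟨f, hf, h1, fun y hy => ⟨s, hs, h2 y hy⟩⟩

theorem isOpen_reg (f : V → k) (hf : f ∈ reg k V) : @IsOpen _ (zariski k V) {v | f v ≠ 0} :=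
  TopologicalSpace.isOpen_generateFrom_of_mem ⟨f, hf, rfl⟩

theorem reg_irr (E : Set V) (hE : @IsIrreducible _ (zariski k V) E) (f g : V → k)
    (hf : f ∈ reg k V) (hg : g ∈ reg k V) (a b : V) (ha : a ∈ E) (hb : b ∈ E)
    (hfa : f a ≠ 0) (hgb : g b ≠ 0) : ∃ c ∈ E, f c ≠ 0 ∧ g c ≠ 0 := by
  let _ := zariski k V
  obtain ⟨c, hc, h1, h2⟩ := hE.2 _ _ (isOpen_reg f hf) (isOpen_reg g hg) ⟨a, ha, hfa⟩ ⟨b, hb, hgb⟩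
  exact ⟨c, hc, h1, h2⟩

/-- The ideal of functions vanishing on a set. -/
def vanI (k : Type*) {V : Type*} [Field k] [AddCommGroup V] [Module k V] (E : Set V) :
    Ideal (reg k V) where
  carrier := {f | ∀ v ∈ E, f.1 v = 0}
  add_mem' := by
    intro a b ha hb v hv
    simp [ha v hv, hb v hv]
  zero_mem' := by intro v hv; rfl
  smul_mem' := by
    intro c a ha v hv
    simp [ha v hv]

theorem mem_vanI {E : Set V} {f : reg k V} : f ∈ vanI k E ↔ ∀ v ∈ E, f.1 v = 0 := Iff.rfl

theorem vanI_anti {E F : Set V} (h : E ⊆ F) : vanI k F ≤ vanI k E := fun _ hf v hv => hf v (h hv)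

/-- A set is `Q`-prime if its vanishing ideal is prime, stated by points. -/
def IsQ (k : Type*) {V : Type*} [Field k] [AddCommGroup V] [Module k V] (E : Set V) : Prop :=
  E.Nonempty ∧ ∀ f ∈ reg k V, ∀ g ∈ reg k V, ∀ a ∈ E, ∀ b ∈ E, f a ≠ 0 → g b ≠ 0 →
    ∃ c ∈ E, f c ≠ 0 ∧ g c ≠ 0

theorem IsQ.prime {E : Set V} (h : IsQ k E) : (vanI k E).IsPrime := by
  refine ⟨?_, ?_⟩
  · obtain ⟨v, hv⟩ := h.1
    rw [Ideal.ne_top_iff_one]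
    intro h1
    exact one_ne_zero (h1 v hv)
  · intro f g hfg
    by_contra! H
    simp only [mem_vanI, not_forall] at H
    obtain ⟨⟨a, ha, hfa⟩, ⟨b, hb, hgb⟩⟩ := H
    obtain ⟨c, hc, h1, h2⟩ := h.2 f.1 f.2 g.1 g.2 a ha b hb hfa hgb
    exact mul_ne_zero h1 h2 (hfg c hc)

/-- The point of the spectrum attached to a `Q`-prime set. -/
def IsQ.pt {E : Set V} (h : IsQ k E) : PrimeSpectrum (reg k V) := ⟨vanI k E, h.prime⟩

theorem IsQ.pt_le {E F : Set V} (hE : IsQ k E) (hF : IsQ k F) (h : E ⊆ F) : hF.pt ≤ hE.pt :=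
  vanI_anti h

theorem IsQ.pt_lt {E F : Set V} (hE : IsQ k E) (hF : IsQ k F) (h : E ⊆ F) (f : V → k)
    (hf : f ∈ reg k V) (h0 : ∀ v ∈ E, f v = 0) (v : V) (hv : v ∈ F) (h1 : f v ≠ 0) :
    hF.pt < hE.pt := by
  refine lt_of_le_of_ne (IsQ.pt_le hE hF h) fun e => ?_
  have e' : vanI k F = vanI k E := congrArg PrimeSpectrum.asIdeal e
  have : (⟨f, hf⟩ : reg k V) ∈ vanI k F := by rw [e']; exact h0
  exact h1 (this v hv)

theorem IsQ.of_irr {E : Set V} (hE : @IsIrreducible _ (zariski k V) E) : IsQ k E :=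
  ⟨hE.1, fun f hf g hg a ha b hb h1 h2 => reg_irr E hE f g hf hg a b ha hb h1 h2⟩

theorem IsQ.irr {E : Set V} (hE : IsQ k E) : @IsIrreducible _ (zariski k V) E := by
  refine ⟨hE.1, ?_⟩
  rintro u v hu hv ⟨a, ha, hau⟩ ⟨b, hb, hbv⟩
  obtain ⟨f, hf, h1, h2⟩ := exists_reg_of_isOpen u hu a hau
  obtain ⟨g, hg, h3, h4⟩ := exists_reg_of_isOpen v hv b hbv
  obtain ⟨c, hc, h5, h6⟩ := hE.2 f hf g hg a ha b hb h1 h3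
  exact ⟨c, hc, h2 c h5, h4 c h6⟩

theorem isQ_affine [Infinite k] (v : V) (K : Submodule k V) : IsQ k {x | ∃ a ∈ K, x = v + a} := by
  refine ⟨⟨v, 0, K.zero_mem, by simp⟩, ?_⟩
  rintro f hf g hg _ ⟨a, ha, rfl⟩ _ ⟨b, hb, rfl⟩ h1 h2
  obtain ⟨c, hc, h3⟩ := reg_affine f g hf hg v K a b ha hb h1 h2
  exact ⟨v + c, ⟨c, hc, rfl⟩, h3⟩

/-- A function separating two translates. -/
theorem exists_sep (v : V) (K : Submodule k V) (b : V) (hb : b ∉ K) :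
    ∃ f ∈ reg k V, (∀ a ∈ K, f (v + a) = 0) ∧ f (v + b) ≠ 0 := by
  obtain ⟨g, hg, hK⟩ := Submodule.exists_dual_map_eq_bot_of_notMem hb inferInstance
  refine ⟨fun x => g x - g v, (reg k V).sub_mem (linear_mem_reg g)
    ((reg k V).algebraMap_mem (g v)), ?_, ?_⟩
  · intro a ha
    have : g a ∈ K.map g := ⟨a, ha, rfl⟩
    rw [hK, Submodule.mem_bot] at this
    simp [this]
  · simpa using hg

theorem finrank_le_coheight [Infinite k] [Module.Finite k V] (v : V) (K : Submodule k V) :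
    (Module.finrank k K : ℕ∞) ≤ Order.coheight (isQ_affine (k := k) v K).pt := by
  rw [← Module.length_eq_finrank, Module.length_eq_height]
  let F : Submodule k K → (PrimeSpectrum (reg k V))ᵒᵈ := fun K' =>
    OrderDual.toDual (isQ_affine (k := k) v (K'.map K.subtype)).pt
  have hF : StrictMono F := by
    intro K₁ K₂ h
    have h' : K₁.map K.subtype < K₂.map K.subtype :=
      Submodule.map_strictMono_of_injective K.injective_subtype h
    obtain ⟨b, hb, hnb⟩ := SetLike.exists_of_lt h'
    obtain ⟨f, hf, h0, h1⟩ := exists_sep v _ b hnb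
    refine OrderDual.toDual_lt_toDual.2 (IsQ.pt_lt _ _ ?_ f hf ?_ (v + b) ⟨b, hb, rfl⟩ h1)
    · rintro _ ⟨a, ha, rfl⟩
      exact ⟨a, h'.le ha, rfl⟩
    · rintro _ ⟨a, ha, rfl⟩
      exact h0 a ha
  have := Order.height_le_height_apply_of_strictMono F hF ⊤
  refine this.trans ?_
  simp only [F, Order.height_toDual]
  apply Order.coheight_anti
  apply IsQ.pt_le
  rintro _ ⟨a, ha, rfl⟩
  exact ⟨a, by simpa using ha, rfl⟩

theorem finrank_le_sdim [Infinite k] [Module.Finite k V] (U : Set V)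
    (hU : @IsOpen _ (zariski k V) U) (hne : U.Nonempty) :
    ((Module.finrank k V : ℕ) : WithBot ℕ∞) ≤ sdim (zariski k V) U := by
  obtain ⟨v, hv⟩ := hne
  have h1 : ((Module.finrank k V : ℕ) : WithBot ℕ∞) = Order.krullDim (Submodule k V) := by
    rw [← Module.coe_length, Module.length_eq_finrank]; rfl
  rw [h1]
  unfold sdim topologicalKrullDim
  let t : TopologicalSpace V := zariski k V
  have hcl : ∀ K : Submodule k V, IsClosed {x | ∃ a ∈ K, x = v + a} := by
    intro K
    rw [← isOpen_compl_iff, isOpen_iff_forall_mem_open]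
    intro x hx
    obtain ⟨f, hf, h0, h1⟩ := exists_sep v K (x - v) (fun h => hx ⟨x - v, h, by abel⟩)
    refine ⟨{y | f y ≠ 0}, ?_, isOpen_reg f hf, by simpa using h1⟩
    rintro y hy ⟨a, ha, rfl⟩
    exact hy (h0 a ha)
  have hirr : ∀ K : Submodule k V,
      IsIrreducible ((Subtype.val : U → V) ⁻¹' {x | ∃ a ∈ K, x = v + a}) := by
    intro K
    refine (isQ_affine (k := k) v K).irr.preimage hU.isOpenEmbedding_subtypeVal
      ⟨v, ⟨0, K.zero_mem, by simp⟩, ⟨v, hv⟩, rfl⟩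
  refine Order.krullDim_le_of_strictMono (fun K : Submodule k V =>
    (⟨(Subtype.val : U → V) ⁻¹' {x | ∃ a ∈ K, x = v + a}, hirr K,
      (hcl K).preimage continuous_subtype_val⟩ : TopologicalSpace.IrreducibleCloseds U)) ?_
  intro K₁ K₂ h
  rw [← SetLike.coe_ssubset_coe]
  refine ⟨?_, ?_⟩
  · rintro x ⟨a, ha, hx⟩
    exact ⟨a, h.le ha, hx⟩
  · intro hsub
    obtain ⟨b, hb, hnb⟩ := SetLike.exists_of_lt h
    obtain ⟨f, hf, h0, h1⟩ := exists_sep v _ b hnb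
    obtain ⟨g, hg, h2, h3⟩ := exists_reg_of_isOpen U hU v hv
    obtain ⟨c, hc, h4, h5⟩ := reg_affine f g hf hg v K₂ b 0 hb K₂.zero_mem h1 (by simpa using h2)
    obtain ⟨a, ha, he⟩ := hsub (show (⟨v + c, h3 _ h5⟩ : U) ∈ _ from ⟨c, hc, rfl⟩)
    have he' : v + c = v + a := he
    rw [he'] at h4
    exact h4 (h0 a ha)

end regs

/-! ### The commuting variety -/

section mats
variable {k V : Type*} [Field k] [AddCommGroup V] [Module k V]

theorem det_mem_reg {n : ℕ} (N : V → Matrix (Fin n) (Fin n) k)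
    (hN : ∀ i j, (fun v => N v i j) ∈ reg k V) : (fun v => (N v).det) ∈ reg k V := by
  have : (fun v => (N v).det) =
      ∑ σ : Equiv.Perm (Fin n), ((Equiv.Perm.sign σ : ℤ) : k) • ∏ i, fun v => N v (σ i) i := by
    funext v
    simp [Matrix.det_apply', Finset.sum_apply, Finset.prod_apply]
  rw [this]
  exact (reg k V).sum_mem fun σ _ => (reg k V).smul_mem ((reg k V).prod_mem fun i _ => hN _ _) _

theorem adjugate_mem_reg {n : ℕ} (N : V → Matrix (Fin n) (Fin n) k)
    (hN : ∀ i j, (fun v => N v i j) ∈ reg k V) (i j : Fin n) :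
    (fun v => (N v).adjugate i j) ∈ reg k V := by
  simp only [Matrix.adjugate_apply]
  apply det_mem_reg
  intro a b
  by_cases h : a = j
  · subst h
    simp only [Matrix.updateRow_self]
    exact (reg k V).algebraMap_mem _
  · simp only [Matrix.updateRow_ne h]
    exact hN a b

theorem vec_mem_reg {n : ℕ} (w : V → Fin n → k) (hw : ∀ i, (fun v => w v i) ∈ reg k V)
    (g : (Fin n → k) →ₗ[k] k) : (fun v => g (w v)) ∈ reg k V := by
  have : (fun v => g (w v)) = ∑ i, g (fun j => if i = j then 1 else 0) • fun v => w v i := by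
    funext v
    rw [LinearMap.pi_apply_eq_sum_univ g (w v)]
    simp [Finset.sum_apply, mul_comm]
  rw [this]
  exact (reg k V).sum_mem fun i _ => (reg k V).smul_mem (hw i) _

end mats

section liepart
variable {k L : Type*} [Field k] [LieRing L] [LieAlgebra k L]

theorem bracket_mem_reg [Module.Finite k L] (g : L →ₗ[k] k) :
    (fun q : L × L => g ⁅q.1, q.2⁆) ∈ reg k (L × L) := by
  let b := Module.finBasis k L
  have : (fun q : L × L => g ⁅q.1, q.2⁆) =
      ∑ i, (fun q : L × L => b.coord i q.1) * fun q : L × L => g ⁅b i, q.2⁆ := by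
    funext q
    have h1 : q.1 = ∑ i, b.coord i q.1 • b i := by simp
    conv_lhs => rw [h1]
    rw [sum_lie]
    simp [map_sum, Finset.sum_apply]
  rw [this]
  refine (reg k _).sum_mem fun i _ => (reg k _).mul_mem ?_ ?_
  · exact linear_mem_reg (b.coord i ∘ₗ LinearMap.fst k L L)
  · exact linear_mem_reg (g ∘ₗ (LieAlgebra.ad k L (b i)) ∘ₗ LinearMap.snd k L L)

/-- The local matrix of `ad x`. -/
noncomputable def Mx {n : ℕ} (ψ : (Fin n → k) →ₗ[k] L) (p : L →ₗ[k] (Fin n → k)) (x : L) :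
    Matrix (Fin n) (Fin n) k :=
  LinearMap.toMatrix' (p ∘ₗ (LieAlgebra.ad k L x : L →ₗ[k] L) ∘ₗ ψ)

variable {n : ℕ} (ψ : (Fin n → k) →ₗ[k] L) (p : L →ₗ[k] (Fin n → k))

theorem Mx_mulVec (x : L) (w : Fin n → k) : (Mx ψ p x).mulVec w = p ⁅x, ψ w⁆ := by
  rw [Mx, LinearMap.toMatrix'_mulVec]
  rfl

theorem Mx_mem_reg (i j : Fin n) : (fun x => Mx ψ p x i j) ∈ reg k L := by
  apply Algebra.subset_adjoin
  constructor
  · intro x y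
    simp [Mx, LinearMap.toMatrix'_apply]
  · intro c x
    simp [Mx, LinearMap.toMatrix'_apply]

theorem Mx_adj (x y : L) : p ⁅x, ψ ((Mx ψ p x).adjugate.mulVec (p y))⁆ = (Mx ψ p x).det • p y := by
  rw [← Mx_mulVec, Matrix.mulVec_mulVec, Matrix.mul_adjugate, Matrix.smul_mulVec,
    Matrix.one_mulVec]

theorem det_Mx_mem_reg : (fun x => (Mx ψ p x).det) ∈ reg k L :=
  det_mem_reg _ (Mx_mem_reg ψ p)

theorem adjvec_mem_reg [Module.Finite k L] (i : Fin n) :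
    (fun q : L × L => (Mx ψ p q.1).adjugate.mulVec (p ⁅q.1, q.2⁆) i) ∈ reg k (L × L) := by
  have : (fun q : L × L => (Mx ψ p q.1).adjugate.mulVec (p ⁅q.1, q.2⁆) i) =
      ∑ j, (fun q : L × L => (Mx ψ p q.1).adjugate i j) * fun q => p ⁅q.1, q.2⁆ j := by
    funext q
    simp [Matrix.mulVec, dotProduct, Finset.sum_apply]
  rw [this]
  refine (reg k _).sum_mem fun j _ => (reg k _).mul_mem ?_ ?_
  · exact comp_mem_reg (V := L × L) (V' := L) Prod.fst
      (fun g => linear_mem_reg (g ∘ₗ LinearMap.fst k L L)) _ (adjugate_mem_reg _ (Mx_mem_reg ψ p) i j)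
  · exact bracket_mem_reg (LinearMap.proj j ∘ₗ p)

theorem exists_psi_p [Module.Finite k L] (x : L) (hx : x ∈ grk k L n) :
    ∃ (ψ : (Fin n → k) →ₗ[k] L) (p : L →ₗ[k] (Fin n → k)), ∀ w, p ⁅x, ψ w⁆ = w := by
  let a : L →ₗ[k] L := LieAlgebra.ad k L x
  have hx' : Module.finrank k (LinearMap.range a) = n := hx
  let e : LinearMap.range a ≃ₗ[k] (Fin n → k) :=
    LinearEquiv.ofFinrankEq _ _ (by rw [hx', Module.finrank_fin_fun])
  obtain ⟨g, hg⟩ := a.rangeRestrict.exists_rightInverse_of_surjective a.range_rangeRestrict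
  obtain ⟨p, hp⟩ := LinearMap.exists_extend (e : LinearMap.range a →ₗ[k] (Fin n → k))
  refine ⟨g ∘ₗ e.symm.toLinearMap, p, fun w => ?_⟩
  have h1 : a.rangeRestrict (g (e.symm w)) = e.symm w := LinearMap.congr_fun hg _
  have h2 := LinearMap.congr_fun hp (a.rangeRestrict (g (e.symm w)))
  have h3 : p ⁅x, g (e.symm w)⁆ = e (a.rangeRestrict (g (e.symm w))) := h2
  show p ⁅x, g (e.symm w)⁆ = w
  rw [h3, h1, e.apply_symm_apply]

theorem Mx_self (x : L) (h : ∀ w, p ⁅x, ψ w⁆ = w) : (Mx ψ p x).det = 1 := by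
  have : p ∘ₗ (LieAlgebra.ad k L x : L →ₗ[k] L) ∘ₗ ψ = LinearMap.id := LinearMap.ext h
  rw [Mx, this, LinearMap.toMatrix'_id, Matrix.det_one]

theorem surj_of_det (x : L) (h : (Mx ψ p x).det ≠ 0) :
    Function.Surjective (p.domRestrict (LinearMap.range (LieAlgebra.ad k L x : L →ₗ[k] L))) := by
  intro w
  refine ⟨⟨⁅x, ψ ((Mx ψ p x)⁻¹.mulVec w)⁆, ⟨_, rfl⟩⟩, ?_⟩
  show p ⁅x, ψ ((Mx ψ p x)⁻¹.mulVec w)⁆ = w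
  rw [← Mx_mulVec, Matrix.mulVec_mulVec, Matrix.mul_nonsing_inv _ (Ne.isUnit h),
    Matrix.one_mulVec]

theorem rank_le_of_det [Module.Finite k L] (x : L) (h : (Mx ψ p x).det ≠ 0) :
    n ≤ Module.finrank k (LinearMap.range (LieAlgebra.ad k L x : L →ₗ[k] L)) := by
  have := LinearMap.finrank_le_finrank_of_surjective (surj_of_det ψ p x h)
  simpa using this

theorem inj_of_det [Module.Finite k L] (x : L) (h : (Mx ψ p x).det ≠ 0) (hx : x ∈ grk k L n)
    (y : L) (hy : p ⁅x, y⁆ = 0) : ⁅x, y⁆ = 0 := by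
  have hinj := (LinearMap.injective_iff_surjective_of_finrank_eq_finrank
    (f := p.domRestrict (LinearMap.range (LieAlgebra.ad k L x : L →ₗ[k] L)))
    (by rw [Module.finrank_fin_fun]; exact hx)).2 (surj_of_det ψ p x h)
  have := @hinj ⟨⁅x, y⁆, ⟨y, rfl⟩⟩ 0 (by rw [map_zero]; exact hy)
  exact congrArg Subtype.val this

/-- Local sections of the bundle of centralizers. -/
theorem exists_section [Module.Finite k L] (x₁ y₁ : L) (hx : x₁ ∈ grk k L n) (hy : ⁅x₁, y₁⁆ = 0)
    (f : L × L → k) (hf : f ∈ reg k (L × L)) (h1 : f (x₁, y₁) ≠ 0) :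
    ∃ F ∈ reg k L, F x₁ ≠ 0 ∧ ∀ x ∈ grk k L n, F x ≠ 0 → ∃ y, ⁅x, y⁆ = 0 ∧ f (x, y) ≠ 0 := by
  obtain ⟨ψ, p, h⟩ := exists_psi_p x₁ hx
  let σ : L → L := fun x => (Mx ψ p x).det • y₁ - ψ ((Mx ψ p x).adjugate.mulVec (p ⁅x, y₁⁆))
  have hσ : ∀ g : L →ₗ[k] k, (fun x => g (σ x)) ∈ reg k L := by
    intro g
    have : (fun x => g (σ x)) = g y₁ • (fun x => (Mx ψ p x).det) -
        fun x => (g ∘ₗ ψ) ((Mx ψ p x).adjugate.mulVec (p ⁅x, y₁⁆)) := by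
      funext x
      simp [σ, mul_comm]
    rw [this]
    refine (reg k L).sub_mem ((reg k L).smul_mem (det_Mx_mem_reg ψ p) _) ?_
    refine vec_mem_reg _ (fun i => ?_) _
    refine comp_mem_reg (V := L) (V' := L × L) (fun x => (x, y₁)) ?_ _ (adjvec_mem_reg ψ p i)
    intro g
    have : (fun x : L => g (x, y₁)) = (fun x => (g ∘ₗ LinearMap.inl k L L) x) +
        algebraMap k (L → k) (g (0, y₁)) := by
      funext x
      simp [← map_add]
    rw [this]
    exact (reg k L).add_mem (linear_mem_reg _) ((reg k L).algebraMap_mem _)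
  refine ⟨(fun x => f (x, σ x)) * fun x => (Mx ψ p x).det, (reg k L).mul_mem ?_
    (det_Mx_mem_reg ψ p), ?_, ?_⟩
  · refine comp_mem_reg (V := L) (V' := L × L) (fun x => (x, σ x)) ?_ f hf
    intro g
    have : (fun x : L => g (x, σ x)) = (fun x => (g ∘ₗ LinearMap.inl k L L) x) +
        (fun x => (g ∘ₗ LinearMap.inr k L L) (σ x)) := by
      funext x
      simp [← map_add]
    rw [this]
    exact (reg k L).add_mem (linear_mem_reg _) (hσ _)
  · have : σ x₁ = y₁ := by simp [σ, hy, Mx_self ψ p x₁ h]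
    simpa [this, Mx_self ψ p x₁ h] using h1
  · intro x hx' hF
    refine ⟨σ x, ?_, left_ne_zero_of_mul hF⟩
    apply inj_of_det ψ p x (right_ne_zero_of_mul hF) hx'
    simp only [σ, lie_sub, lie_smul, map_sub, map_smul]
    rw [Mx_adj, sub_self]

theorem isQ_bundle [Module.Finite k L] [Infinite k] (S : Set L) (hS : IsQ k S)
    (hSn : S ⊆ grk k L n) : IsQ k {q : L × L | q.1 ∈ S ∧ ⁅q.1, q.2⁆ = 0} := by
  refine ⟨?_, ?_⟩
  · obtain ⟨x, hx⟩ := hS.1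
    exact ⟨(x, 0), hx, by simp⟩
  · rintro f hf g hg ⟨x₁, y₁⟩ ⟨hx₁, hy₁⟩ ⟨x₂, y₂⟩ ⟨hx₂, hy₂⟩ h1 h2
    obtain ⟨F, hF, h3, h4⟩ := exists_section x₁ y₁ (hSn hx₁) hy₁ f hf h1
    obtain ⟨G, hG, h5, h6⟩ := exists_section x₂ y₂ (hSn hx₂) hy₂ g hg h2
    obtain ⟨x, hx, h7, h8⟩ := hS.2 F hF G hG x₁ hx₁ x₂ hx₂ h3 h5
    obtain ⟨y, hy, h9⟩ := h4 x (hSn hx) h7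
    obtain ⟨z, hz, h10⟩ := h6 x (hSn hx) h8
    obtain ⟨c, ⟨c', hc', rfl⟩, h11⟩ := reg_affine f g hf hg (x, 0)
      ((LinearMap.ker (LieAlgebra.ad k L x : L →ₗ[k] L)).map (LinearMap.inr k L L))
      (0, y) (0, z) ⟨y, hy, rfl⟩ ⟨z, hz, rfl⟩ (by simpa using h9) (by simpa using h10)
    refine ⟨_, ⟨?_, ?_⟩, h11⟩
    · simpa using hx
    · have : ⁅x, c'⁆ = 0 := hc'
      simpa using this

end liepart

section dimbound
variable {k L : Type*} [Field k] [LieRing L] [LieAlgebra k L]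

/-- Pullback of regular functions along a linear map. -/
def pb {V V' : Type*} [AddCommGroup V] [Module k V] [AddCommGroup V'] [Module k V']
    (φ : V →ₗ[k] V') : reg k V' →ₐ[k] reg k V where
  toFun f := ⟨fun v => f.1 (φ v), comp_mem_reg φ (fun g => linear_mem_reg (g ∘ₗ φ)) f.1 f.2⟩
  map_one' := rfl
  map_mul' _ _ := rfl
  map_zero' := rfl
  map_add' _ _ := rfl
  commutes' _ := rfl

theorem map_mem_adjoin {V : Type*} [AddCommGroup V] [Module k V] {ι : Type*} [Fintype ι]
    (b : Module.Basis ι k V) {A : Type*} [CommRing A] [Algebra k A] (Φ : reg k V →ₐ[k] A)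
    (f : reg k V) : Φ f ∈ Algebra.adjoin k
      (Set.range fun i => Φ ⟨fun v => b.coord i v, linear_mem_reg (b.coord i)⟩) := by
  obtain ⟨f, hf⟩ := f
  induction hf using Algebra.adjoin_induction with
  | mem x hx =>
    have : (⟨x, Algebra.subset_adjoin hx⟩ : reg k V) =
        ∑ i, x (b i) • ⟨fun v => b.coord i v, linear_mem_reg (b.coord i)⟩ := by
      apply Subtype.ext
      funext v
      have h1 : x v = ∑ i, x (b i) * b.coord i v := by
        have h2 : hx.mk' x v = ∑ i, hx.mk' x (b i) * b.coord i v := by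
          conv_lhs => rw [← b.sum_repr v]
          rw [map_sum]
          refine Finset.sum_congr rfl fun i _ => ?_
          rw [map_smul, smul_eq_mul, mul_comm]
          rfl
        exact h2
      show x v = _
      rw [h1]
      simp [Finset.sum_apply]
    rw [this, map_sum]
    refine Subalgebra.sum_mem _ fun i _ => ?_
    rw [map_smul]
    exact Subalgebra.smul_mem _ (Algebra.subset_adjoin (Set.mem_range_self i)) _
  | algebraMap r =>
    have := Φ.commutes r
    exact this ▸ Subalgebra.algebraMap_mem _ r
  | add x y hx hy h1 h2 =>
    have := Subalgebra.add_mem _ h1 h2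
    rwa [← map_add] at this
  | mul x y hx hy h1 h2 =>
    have := Subalgebra.mul_mem _ h1 h2
    rwa [← map_mul] at this

set_option maxHeartbeats 1000000 in
theorem trdeg_comm_le [Module.Finite k L] {A : Type*} [CommRing A] [IsDomain A] [Algebra k A]
    (Q : reg k (L × L) →ₐ[k] A) (hsurj : Function.Surjective Q)
    (hQ : ∀ f g : reg k (L × L), (∀ x y : L, ⁅x, y⁆ = 0 → f.1 (x, y) = g.1 (x, y)) → Q f = Q g)
    (hQ0 : ∀ f : reg k (L × L), Q f = 0 → ∀ x y : L, ⁅x, y⁆ = 0 → f.1 (x, y) = 0)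
    {n : ℕ} (x₀ : L) (hx : x₀ ∈ grk k L n) :
    ∃ N : ℕ, N + n = 2 * Module.finrank k L ∧ Algebra.trdeg k A ≤ (N : Cardinal) := by
  obtain ⟨ψ, p, h⟩ := exists_psi_p x₀ hx
  let a : L →ₗ[k] L := LieAlgebra.ad k L x₀
  let U : Submodule k L := LinearMap.ker (p ∘ₗ a)
  have hdim : n + Module.finrank k U = Module.finrank k L := by
    have h1 := LinearMap.finrank_range_add_finrank_ker (p ∘ₗ a)
    have h2 : LinearMap.range (p ∘ₗ a) = ⊤ := LinearMap.range_eq_top.2 fun w => ⟨ψ w, h w⟩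
    rw [h2, finrank_top, Module.finrank_fin_fun] at h1
    exact h1
  let θ : L →ₗ[k] U := LinearMap.codRestrict U (LinearMap.id - ψ ∘ₗ p ∘ₗ a) (by
    intro y
    show p ⁅x₀, y - ψ (p ⁅x₀, y⁆)⁆ = 0
    rw [lie_sub, map_sub, h, sub_self])
  have hθ : ∀ y, (θ y : L) = y - ψ (p ⁅x₀, y⁆) := fun y => rfl
  let Θ : L × L →ₗ[k] L × U := LinearMap.prodMap LinearMap.id θ
  let ι : L × U →ₗ[k] L × L := LinearMap.prodMap LinearMap.id U.subtype
  let Φ : reg k (L × U) →ₐ[k] A := Q.comp (pb Θ)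
  let b := Module.finBasis k (L × U)
  let s : Set A :=
    Set.range fun i => Φ ⟨fun v => b.coord i v, linear_mem_reg (b.coord i)⟩
  have hs : ∀ f, Φ f ∈ Algebra.adjoin k s := map_mem_adjoin b Φ
  -- the determinant
  let D : reg k (L × L) := pb (LinearMap.fst k L L) ⟨_, det_Mx_mem_reg ψ p⟩
  have hD : Q D ∈ Algebra.adjoin k s := hs (pb (LinearMap.fst k L U) ⟨_, det_Mx_mem_reg ψ p⟩)
  have hD0 : Q D ≠ 0 := by
    intro h0
    have h2 : (Mx ψ p x₀).det = 0 := hQ0 D h0 x₀ 0 (by simp)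
    rw [Mx_self ψ p x₀ h] at h2
    exact one_ne_zero h2
  have halg : Algebra.IsAlgebraic (Algebra.adjoin k s) A := by
    constructor
    intro z
    obtain ⟨⟨f, hf⟩, rfl⟩ := hsurj z
    induction hf using Algebra.adjoin_induction with
    | mem x hx =>
      let g : L × L →ₗ[k] k := hx.mk' x
      let f₁ : reg k (L × U) := ⟨fun v => (g ∘ₗ ι) v, linear_mem_reg (g ∘ₗ ι)⟩
      let lam : L × L →ₗ[k] k := g ∘ₗ LinearMap.inr k L L ∘ₗ ψ ∘ₗ p ∘ₗ a ∘ₗ LinearMap.snd k L L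
      let f₂ : reg k (L × L) := ⟨fun v => lam v, linear_mem_reg lam⟩
      have e1 : Q ⟨x, Algebra.subset_adjoin hx⟩ = Φ f₁ + Q f₂ := by
        show _ = Q (pb Θ f₁) + Q f₂
        rw [← map_add]
        congr 1
        apply Subtype.ext
        funext v
        show g v = g (v.1, (θ v.2 : L)) + g (0, ψ (p ⁅x₀, v.2⁆))
        rw [← map_add, hθ]
        simp
      rw [e1]
      refine IsAlgebraic.add (isAlgebraic_algebraMap (⟨Φ f₁, hs f₁⟩ : Algebra.adjoin k s)) ?_
      let f₃ : reg k (L × L) := ⟨fun q => -((g ∘ₗ LinearMap.inr k L L ∘ₗ ψ)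
        ((Mx ψ p q.1).adjugate.mulVec (p ⁅q.1, q.2⁆))),
        (reg k _).neg_mem (vec_mem_reg _ (adjvec_mem_reg ψ p) _)⟩
      have e2 : Q D * Q f₂ = Φ (pb ι f₃) := by
        show _ = Q (pb Θ (pb ι f₃))
        rw [← map_mul]
        apply hQ
        intro x y hxy
        show (Mx ψ p x).det * g (0, ψ (p ⁅x₀, y⁆)) =
          -(g (0, ψ ((Mx ψ p x).adjugate.mulVec (p ⁅x, (θ y : L)⁆))))
        have e3 : p ⁅x, (θ y : L)⁆ = -(Mx ψ p x).mulVec (p ⁅x₀, y⁆) := by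
          rw [hθ, lie_sub, hxy, Mx_mulVec, zero_sub, map_neg]
        rw [e3, Matrix.mulVec_neg, Matrix.mulVec_mulVec, Matrix.adjugate_mul, Matrix.smul_mulVec,
          Matrix.one_mulVec, map_neg, map_smul]
        have e4 : ((0 : L), -((Mx ψ p x).det • ψ (p ⁅x₀, y⁆))) =
            -((Mx ψ p x).det • ((0 : L), ψ (p ⁅x₀, y⁆))) := by simp
        rw [e4, map_neg, map_smul, neg_neg, smul_eq_mul]
      refine ⟨Polynomial.C ⟨Q D, hD⟩ * Polynomial.X - Polynomial.C ⟨Φ (pb ι f₃), hs _⟩, ?_, ?_⟩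
      · intro h0
        have := congrArg (fun P => Polynomial.coeff P 1) h0
        simp [Polynomial.coeff_C] at this
        exact hD0 (congrArg Subtype.val this)
      · simp only [map_sub, map_mul, Polynomial.aeval_C, Polynomial.aeval_X]
        exact sub_eq_zero.2 e2
    | algebraMap r =>
      have e := Q.commutes r
      have e' := isAlgebraic_algebraMap (A := A) (algebraMap k (Algebra.adjoin k s) r)
      rw [← IsScalarTower.algebraMap_apply k (Algebra.adjoin k s) A, ← e] at e'
      exact e'
    | add x y hx hy h1 h2 =>
      have e := IsAlgebraic.add h1 h2
      rwa [← map_add] at e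
    | mul x y hx hy h1 h2 =>
      have e := IsAlgebraic.mul h1 h2
      rwa [← map_mul] at e
  have htr : Algebra.trdeg k A ≤
      ((Module.finrank k (L × U) : ℕ) : Cardinal) := by
    refine (Algebra.IsAlgebraic.trdeg_le_cardinalMk k s).trans ?_
    have := Cardinal.mk_range_le_lift
      (f := fun i => Φ ⟨fun v => b.coord i v, linear_mem_reg (b.coord i)⟩)
    rw [Cardinal.mk_fin, Cardinal.lift_natCast] at this
    rw [← Cardinal.lift_le, Cardinal.lift_natCast]
    exact this
  refine ⟨_, ?_, htr⟩
  rw [Module.finrank_prod]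
  omega

set_option maxHeartbeats 4000000 in
theorem coheight_commSet_le [Module.Finite k L] (hC : IsQ k (commSet L)) {n : ℕ} (x₀ : L)
    (hx : x₀ ∈ grk k L n) :
    Order.coheight hC.pt + n ≤ ((2 * Module.finrank k L : ℕ) : ℕ∞) := by
  have hprime : (vanI k (commSet L)).IsPrime := hC.prime
  have hA : ∀ f g : reg k (L × L), (∀ x y : L, ⁅x, y⁆ = 0 → f.1 (x, y) = g.1 (x, y)) →
      Ideal.Quotient.mkₐ k (vanI k (commSet L)) f = Ideal.Quotient.mkₐ k (vanI k (commSet L)) g := by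
    intro f g hfg
    rw [Ideal.Quotient.mkₐ_eq_mk, Ideal.Quotient.eq, mem_vanI]
    rintro ⟨x, y⟩ hxy
    show f.1 (x, y) - g.1 (x, y) = 0
    rw [hfg x y hxy, sub_self]
  have hB : ∀ f : reg k (L × L), Ideal.Quotient.mkₐ k (vanI k (commSet L)) f = 0 →
      ∀ x y : L, ⁅x, y⁆ = 0 → f.1 (x, y) = 0 := by
    intro f h0 x y hxy
    rw [Ideal.Quotient.mkₐ_eq_mk, Ideal.Quotient.eq_zero_iff_mem, mem_vanI] at h0
    exact h0 (x, y) hxy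
  have hS : Function.Surjective (Ideal.Quotient.mkₐ k (vanI k (commSet L))) := by
    apply Ideal.Quotient.mkₐ_surjective
  have hdom : IsDomain (reg k (L × L) ⧸ vanI k (commSet L)) := Ideal.Quotient.isDomain _
  obtain ⟨N, hN, htr⟩ := trdeg_comm_le (k := k) (L := L)
    (A := reg k (L × L) ⧸ vanI k (commSet L)) (Ideal.Quotient.mkₐ k (vanI k (commSet L)))
    hS hA hB x₀ hx
  have h1 := aux_coheight_le N hC.pt htr
  rw [← hN, Nat.cast_add]
  gcongr

end dimbound

section final
variable {k L : Type*} [Field k] [LieRing L] [LieAlgebra k L]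

theorem isOpen_max_stratum [Module.Finite k L] (n₀ : ℕ)
    (h2 : ∀ n : ℕ, (grk k L n).Nonempty → n ≤ n₀) :
    @IsOpen _ (zariski k L) (grk k L n₀) := by
  let _ := zariski k L
  rw [isOpen_iff_forall_mem_open]
  intro x hx
  obtain ⟨ψ, p, h⟩ := exists_psi_p x hx
  refine ⟨{y | (Mx ψ p y).det ≠ 0}, ?_, isOpen_reg _ (det_Mx_mem_reg ψ p), ?_⟩
  · intro y hy
    exact le_antisymm (h2 _ ⟨y, rfl⟩) (rank_le_of_det ψ p y hy)
  · show (Mx ψ p x).det ≠ 0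
    rw [Mx_self ψ p x h]
    exact one_ne_zero

theorem chain_bound [Module.Finite k L] [Infinite k] (hC : IsQ k (commSet L)) (n₀ : ℕ)
    (h1 : (grk k L n₀).Nonempty) (n : ℕ) (hlt : n < n₀) (r : ℕ)
    (hr : (r : WithBot ℕ∞) ≤ sdim (zariski k L) (grk k L n)) :
    r + n₀ < Module.finrank k L + n := by
  let t : TopologicalSpace L := zariski k L
  let t' : TopologicalSpace (grk k L n) := TopologicalSpace.induced Subtype.val t
  obtain ⟨l, hl⟩ := Order.le_krullDim_iff.1 hr
  have hcont : Continuous (Subtype.val : grk k L n → L) := continuous_induced_dom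
  let S : TopologicalSpace.IrreducibleCloseds (grk k L n) → Set L := fun Z => Subtype.val '' Z.carrier
  have hS : ∀ Z, IsQ k (S Z) := fun Z =>
    IsQ.of_irr (Z.isIrreducible'.image _ hcont.continuousOn)
  have hSn : ∀ Z, S Z ⊆ grk k L n := by
    rintro Z _ ⟨x, -, rfl⟩
    exact x.2
  have hE : ∀ Z, IsQ k {q : L × L | q.1 ∈ S Z ∧ ⁅q.1, q.2⁆ = 0} := fun Z =>
    isQ_bundle (S Z) (hS Z) (hSn Z)
  have hmono : ∀ Z Z', Z < Z' → (hE Z').pt < (hE Z).pt := by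
    intro Z Z' hZ
    rw [← SetLike.coe_ssubset_coe] at hZ
    obtain ⟨x, hx, hnx⟩ := Set.exists_of_ssubset hZ
    obtain ⟨O, hO, hO'⟩ := isOpen_induced_iff.1 Z.isClosed'.isOpen_compl
    have hxO : (x : L) ∈ O := by
      have : x ∈ Subtype.val ⁻¹' O := by rw [hO']; exact hnx
      exact this
    obtain ⟨f, hf, h3, h4⟩ := exists_reg_of_isOpen O hO x hxO
    refine IsQ.pt_lt (hE Z) (hE Z') ?_ (fun q => f q.1) (comp_mem_reg Prod.fst
      (fun g => linear_mem_reg (g ∘ₗ LinearMap.fst k L L)) f hf) ?_ (x, 0) ⟨⟨x, hx, rfl⟩, by simp⟩ h3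
    · rintro q ⟨⟨y, hy, hq⟩, h⟩
      exact ⟨⟨y, hZ.1 hy, hq⟩, h⟩
    · rintro q ⟨⟨y, hy, hq⟩, h⟩
      by_contra hne
      rw [← hq] at hne
      have : y ∈ Subtype.val ⁻¹' O := h4 _ hne
      rw [hO'] at this
      exact this hy
  -- base of the chain
  have hbase : ∀ Z, ((Module.finrank k L - n : ℕ) : ℕ∞) ≤ Order.coheight (hE Z).pt := by
    intro Z
    obtain ⟨z, hz⟩ := (hS Z).1
    let K := (LinearMap.ker (LieAlgebra.ad k L z : L →ₗ[k] L)).map (LinearMap.inr k L L)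
    have h3 := finrank_le_coheight (k := k) ((z, 0) : L × L) K
    have h4 : Module.finrank k K = Module.finrank k L - n := by
      have h5 := LinearMap.finrank_range_add_finrank_ker (LieAlgebra.ad k L z : L →ₗ[k] L)
      have h6 : Module.finrank k (LinearMap.range (LieAlgebra.ad k L z : L →ₗ[k] L)) = n := hSn Z hz
      have h7 : Module.finrank k K =
          Module.finrank k (LinearMap.ker (LieAlgebra.ad k L z : L →ₗ[k] L)) :=
        (LinearEquiv.finrank_eq (Submodule.equivMapOfInjective _ LinearMap.inr_injective _)).symm
      omega
    rw [← h4]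
    refine h3.trans (Order.coheight_anti (IsQ.pt_le _ _ ?_))
    rintro _ ⟨_, ⟨y, hy, rfl⟩, rfl⟩
    have hy' : ⁅z, y⁆ = 0 := hy
    exact ⟨by simpa using hz, by simpa using hy'⟩
  have hstep : ∀ i : ℕ, ∀ hi : i < l.length + 1,
      ((Module.finrank k L - n + i : ℕ) : ℕ∞) ≤ Order.coheight (hE (l ⟨i, hi⟩)).pt := by
    intro i
    induction i with
    | zero => intro hi; simpa using hbase _
    | succ i ih =>
      intro hi
      have h3 := ih (by omega)
      have h4 := Order.coheight_add_one_le (hmono (l ⟨i, by omega⟩) (l ⟨i + 1, hi⟩)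
        (l.strictMono (Fin.mk_lt_mk.2 (Nat.lt_succ_self i))))
      refine le_trans ?_ h4
      rw [← add_assoc, Nat.cast_add]
      exact add_le_add_left h3 _
  have hlast := hstep l.length (Nat.lt_succ_self _)
  obtain ⟨x₀, hx₀⟩ := h1
  obtain ⟨ψ, p, h⟩ := exists_psi_p x₀ hx₀
  have htop : hC.pt < (hE (l ⟨l.length, Nat.lt_succ_self _⟩)).pt := by
    refine IsQ.pt_lt _ hC (fun q hq => hq.2) (fun q => (Mx ψ p q.1).det) (comp_mem_reg Prod.fst
      (fun g => linear_mem_reg (g ∘ₗ LinearMap.fst k L L)) _ (det_Mx_mem_reg ψ p)) ?_ (x₀, 0)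
      (by simp [commSet]) ?_
    · rintro q ⟨hq, -⟩
      by_contra hne
      have h3 := rank_le_of_det ψ p q.1 hne
      have h4 : Module.finrank k (LinearMap.range (LieAlgebra.ad k L q.1 : L →ₗ[k] L)) = n :=
        hSn _ hq
      omega
    · rw [Mx_self ψ p x₀ h]
      exact one_ne_zero
  have h5 := Order.coheight_add_one_le htop
  have h6 := coheight_commSet_le hC x₀ hx₀
  have h7 : ((Module.finrank k L - n + l.length + 1 + n₀ : ℕ) : ℕ∞) ≤
      ((2 * Module.finrank k L : ℕ) : ℕ∞) := by
    refine le_trans ?_ h6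
    push_cast
    push_cast at hlast
    gcongr
    exact le_trans (by gcongr) h5
  have h8 : Module.finrank k L - n + l.length + 1 + n₀ ≤ 2 * Module.finrank k L := by
    exact_mod_cast h7
  omega

end final

/-- if `C₂(𝔤)` is irreducible, then for `n` with `𝔤₍ₙ₎ ≠ ∅` one has
`dim 𝔤₍ₙ₎ − n = mod(𝔤)` iff `n = max{m : 𝔤₍ₘ₎ ≠ ∅}`.  Here `m = mod(𝔤)` is
characterized by the two hypotheses `hm1`, `hm2`, and `n₀` is the maximum of the
nonempty strata. -/
theorem stratum_realizes_mod_iff_max (k L : Type*) [Field k] [IsAlgClosed k]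
    [LieRing L] [LieAlgebra k L] [Module.Finite k L]
    (hirr : @IsIrreducible _ (zariski k (L × L)) (commSet L))
    (m : ℕ)
    (hm1 : ∀ n : ℕ, (grk k L n).Nonempty →
      sdim (zariski k L) (grk k L n) ≤ ((m + n : ℕ) : WithBot ℕ∞))
    (hm2 : ∃ n : ℕ, (grk k L n).Nonempty ∧
      sdim (zariski k L) (grk k L n) = ((m + n : ℕ) : WithBot ℕ∞))
    (n₀ : ℕ) (h1 : (grk k L n₀).Nonempty) (h2 : ∀ n : ℕ, (grk k L n).Nonempty → n ≤ n₀)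
    (n : ℕ) (hn : (grk k L n).Nonempty) :
    sdim (zariski k L) (grk k L n) = ((m + n : ℕ) : WithBot ℕ∞) ↔ n = n₀ := by
  have hinf : Infinite k := inferInstance
  have hC : IsQ k (commSet L) := IsQ.of_irr hirr
  have hA : Module.finrank k L ≤ m + n₀ := by
    have h3 := (finrank_le_sdim _ (isOpen_max_stratum n₀ h2) h1).trans (hm1 n₀ h1)
    exact_mod_cast h3
  have key : ∀ j : ℕ, (grk k L j).Nonempty →
      sdim (zariski k L) (grk k L j) = ((m + j : ℕ) : WithBot ℕ∞) → j = n₀ := by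
    intro j hj he
    by_contra hne
    have hlt : j < n₀ := lt_of_le_of_ne (h2 j hj) hne
    have := chain_bound hC n₀ h1 j hlt (m + j) he.ge
    omega
  constructor
  · exact key n hn
  · rintro rfl
    obtain ⟨j, hj, he⟩ := hm2
    obtain rfl := key j hj he
    exact he
end
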